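/- arXiv:1709.05762 — 10 statements merged into one kernel-verified Lean document; each statement's English description precedes it below -/
import Mathlib

section
/- Let 0 → J₁ → J₂ → J₃ → 0 be a short exact sequence of R[H⁺]-modules, with R-linear H⁺-equivariant maps. Then J₂ is finitely surjective if and only if both J₁ and J₃ are finitely surjective. -/
/-- An `R[H⁺]`-module `(J, ρ)` is finitely surjective if `J` is finitely generated as an
`R`-module and every `t ∈ H⁺` acts surjectively on `J`. -/
def IsFinSurj (R : Type*) [CommRing R] {H : Type*} [CommMonoid H]
    (J : Type*) [AddCommGroup J] [Module R J] (ρ : H →* Module.End R J) : Prop :=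
  Module.Finite R J ∧ ∀ t : H, Function.Surjective ⇑(ρ t)

/-- Let `0 → J₁ → J₂ → J₃ → 0` be a short exact sequence of `R[H⁺]`-modules (with `R`-linear
`H⁺`-equivariant maps), over a commutative Noetherian ring `R` and a commutative monoid `H⁺`.
Then `J₂` is finitely surjective if and only if both `J₁` and `J₃` are finitely surjective. -/
theorem finitelySurjective_shortExact
    (R : Type*) [CommRing R] [IsNoetherianRing R]
    {H : Type*} [CommMonoid H]
    (J₁ J₂ J₃ : Type*)
    [AddCommGroup J₁] [Module R J₁] [AddCommGroup J₂] [Module R J₂]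
    [AddCommGroup J₃] [Module R J₃]
    (ρ₁ : H →* Module.End R J₁) (ρ₂ : H →* Module.End R J₂) (ρ₃ : H →* Module.End R J₃)
    (f : J₁ →ₗ[R] J₂) (g : J₂ →ₗ[R] J₃)
    (hf : Function.Injective ⇑f) (hg : Function.Surjective ⇑g)
    (hexact : LinearMap.range f = LinearMap.ker g)
    (hfe : ∀ (t : H) (x : J₁), f (ρ₁ t x) = ρ₂ t (f x))
    (hge : ∀ (t : H) (x : J₂), g (ρ₂ t x) = ρ₃ t (g x)) :
    IsFinSurj R J₂ ρ₂ ↔ (IsFinSurj R J₁ ρ₁ ∧ IsFinSurj R J₃ ρ₃) := by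
  constructor
  · rintro ⟨hfin, hsurj⟩
    have hfin₁ : Module.Finite R J₁ := Module.Finite.of_injective f hf
    have hfin₃ : Module.Finite R J₃ := Module.Finite.of_surjective g hg
    have hsurj₃ : ∀ t : H, Function.Surjective ⇑(ρ₃ t) := by
      intro t z
      obtain ⟨y, rfl⟩ := hg z
      obtain ⟨y, rfl⟩ := hsurj t y
      exact ⟨g y, (hge t y).symm⟩
    refine ⟨⟨hfin₁, fun t x => ?_⟩, hfin₃, hsurj₃⟩
    have hinj : Function.Injective ⇑(ρ₃ t) :=
      IsNoetherian.injective_of_surjective_endomorphism (ρ₃ t) (hsurj₃ t)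
    obtain ⟨y, hy⟩ := hsurj t (f x)
    have hgf : g (f x) = 0 := by
      rw [← LinearMap.mem_ker, ← hexact]
      exact LinearMap.mem_range_self f x
    have hgy : y ∈ LinearMap.ker g := by
      rw [LinearMap.mem_ker]
      apply hinj
      rw [← hge, hy, hgf, map_zero]
    rw [← hexact] at hgy
    obtain ⟨w, rfl⟩ := hgy
    exact ⟨w, hf (by rw [hfe, hy])⟩
  · rintro ⟨⟨hfin₁, hsurj₁⟩, hfin₃, hsurj₃⟩
    have hnoeth : IsNoetherian R J₂ := isNoetherian_of_range_eq_ker f g hexact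
    refine ⟨inferInstance, fun t y => ?_⟩
    obtain ⟨z, hz⟩ := hsurj₃ t (g y)
    obtain ⟨w, rfl⟩ := hg z
    have hker : y - ρ₂ t w ∈ LinearMap.ker g := by
      rw [LinearMap.mem_ker, map_sub, hge, hz, sub_self]
    rw [← hexact] at hker
    obtain ⟨x, hx⟩ := hker
    obtain ⟨x, rfl⟩ := hsurj₁ t x
    refine ⟨f x + w, ?_⟩
    rw [map_add, ← hfe, hx, sub_add_cancel]
end

section
/- Assume H⁺ has a dominating element t₊. Let J be an R[H⁺]-module which is finitely generated as an R-module. Then J_fsu = ⋂_{t ∈ H⁺} t·J = ⋂_{k ≥ 0} t₊ᵏ·J, where t·J denotes the image of J under the action of t. -/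
/-- A submodule `N` of an `R[H⁺]`-module `(J, ρ)` is an `H⁺`-stable submodule which is finitely
surjective for the restricted action: `N` is finitely generated, stable under the action of every
`t ∈ H⁺`, and every `t ∈ H⁺` acts surjectively on `N`. -/
def IsFinSurjSub (R : Type*) [CommRing R] {H : Type*} [CommMonoid H]
    {J : Type*} [AddCommGroup J] [Module R J] (ρ : H → Module.End R J)
    (N : Submodule R J) : Prop :=
  N.FG ∧ (∀ t : H, ∀ x ∈ N, ρ t x ∈ N) ∧ (∀ t : H, ∀ x ∈ N, ∃ y ∈ N, ρ t y = x)

/-- The finitely surjective part `J_fsu` of an `R[H⁺]`-module: the sum of all `H⁺`-stable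
`R`-submodules of `J` that are finitely surjective for the restricted action. -/
def fsuPart (R : Type*) [CommRing R] {H : Type*} [CommMonoid H]
    (J : Type*) [AddCommGroup J] [Module R J] (ρ : H → Module.End R J) : Submodule R J :=
  sSup {N | IsFinSurjSub R ρ N}

/-- An element `tp` of a commutative monoid `H⁺` is dominating if for every `t ∈ H⁺` one has
`tp ^ k ∈ t · H⁺` for all sufficiently large `k`. -/
def Dominating {H : Type*} [CommMonoid H] (tp : H) : Prop :=
  ∀ t : H, ∃ K : ℕ, ∀ k ≥ K, ∃ s : H, tp ^ k = t * s

/-- A Noetherian endomorphism `f` maps `⋂ k, range (f ^ k)` onto itself. -/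
theorem Module.End.exists_mem_iInf_range_pow_apply_eq
    {R : Type*} [CommRing R] {J : Type*} [AddCommGroup J] [Module R J] [IsNoetherian R J]
    (f : Module.End R J) {x : J} (hx : x ∈ ⨅ k : ℕ, LinearMap.range (f ^ k)) :
    ∃ y ∈ ⨅ k : ℕ, LinearMap.range (f ^ k), f y = x := by
  simp only [Submodule.mem_iInf, LinearMap.mem_range] at hx ⊢
  choose z hz using hx
  obtain ⟨n, hn, hn1⟩ :=
    (f.eventually_disjoint_ker_pow_range_pow.and (Filter.eventually_ge_atTop 1)).exists
  have hfz (k : ℕ) : f ((f ^ k) (z (k + 1))) = x := by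
    rw [← Module.End.mul_apply, ← pow_succ', hz]
  refine ⟨(f ^ n) (z (n + 1)), fun k => ?_, hfz n⟩
  -- The preimage `f ^ m (z (m + 1))` of `x` does not depend on `m ≥ n`.
  have key : (f ^ (n + k)) (z (n + k + 1)) = (f ^ n) (z (n + 1)) := by
    rw [← sub_eq_zero]
    refine Submodule.disjoint_def.1 hn _ ?_ ?_
    · obtain ⟨m, rfl⟩ := Nat.exists_eq_add_of_le' hn1
      rw [LinearMap.mem_ker, pow_succ f m, Module.End.mul_apply (f ^ m) f, map_sub, hfz, ← pow_succ,
        hfz, sub_self, map_zero]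
    · rw [pow_add, Module.End.mul_apply]
      exact sub_mem (LinearMap.mem_range_self _ _) (LinearMap.mem_range_self _ _)
  exact ⟨(f ^ n) (z (n + k + 1)), by rw [← key, add_comm n k, pow_add, Module.End.mul_apply]⟩

theorem fsuPart_le_iInf_range
    (R : Type*) [CommRing R] {H : Type*} [CommMonoid H]
    (J : Type*) [AddCommGroup J] [Module R J] (ρ : H → Module.End R J) :
    fsuPart R J ρ ≤ ⨅ t : H, LinearMap.range (ρ t) := by
  refine sSup_le fun N hN => le_iInf fun t x hx => ?_
  obtain ⟨y, -, hy⟩ := hN.2.2 t x hx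
  exact ⟨y, hy⟩

theorem isFinSurjSub_iInf_range_pow
    {R : Type*} [CommRing R] {H : Type*} [CommMonoid H]
    {J : Type*} [AddCommGroup J] [Module R J] [IsNoetherian R J]
    (ρ : H →* Module.End R J) {tp : H} (hdom : Dominating tp) :
    IsFinSurjSub R ρ (⨅ k : ℕ, LinearMap.range (ρ (tp ^ k))) := by
  have stable (t : H) (x : J) (hx : x ∈ ⨅ k : ℕ, LinearMap.range (ρ (tp ^ k))) :
      ρ t x ∈ ⨅ k : ℕ, LinearMap.range (ρ (tp ^ k)) := by
    refine (Submodule.mem_iInf _).2 fun k => ?_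
    obtain ⟨y, rfl⟩ := (Submodule.mem_iInf _).1 hx k
    exact ⟨ρ t y, by simp only [← Module.End.mul_apply, ← map_mul, mul_comm]⟩
  have surj_pow (k : ℕ) : ∀ x ∈ ⨅ k : ℕ, LinearMap.range (ρ (tp ^ k)),
      ∃ y ∈ ⨅ k : ℕ, LinearMap.range (ρ (tp ^ k)), ρ (tp ^ k) y = x := by
    induction k with
    | zero => exact fun x hx => ⟨x, hx, by simp⟩
    | succ k ih =>
      intro x hx
      obtain ⟨y, hy, rfl⟩ := ih x hx
      simp only [map_pow] at hy ⊢
      obtain ⟨w, hw, rfl⟩ := (ρ tp).exists_mem_iInf_range_pow_apply_eq hy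
      exact ⟨w, hw, by rw [pow_succ, Module.End.mul_apply]⟩
  refine ⟨IsNoetherian.noetherian _, stable, fun t x hx => ?_⟩
  obtain ⟨K, hK⟩ := hdom t
  obtain ⟨s, hs⟩ := hK K le_rfl
  obtain ⟨y, hy, rfl⟩ := surj_pow K x hx
  exact ⟨ρ s y, stable s y hy, by rw [hs, map_mul, Module.End.mul_apply]⟩

/-- Assume `H⁺` has a dominating element `tp`.  Let `J` be an `R[H⁺]`-module which is finitely
generated as an `R`-module (`R` commutative Noetherian).  Then
`J_fsu = ⋂_{t ∈ H⁺} t·J = ⋂_{k ≥ 0} tpᵏ·J`. -/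
theorem fsuPart_eq_iInf_range
    (R : Type*) [CommRing R] [IsNoetherianRing R]
    {H : Type*} [CommMonoid H]
    (J : Type*) [AddCommGroup J] [Module R J] [Module.Finite R J]
    (ρ : H →* Module.End R J) (tp : H) (hdom : Dominating tp) :
    (fsuPart R J ⇑ρ = ⨅ t : H, LinearMap.range (ρ t)) ∧
      (fsuPart R J ⇑ρ = ⨅ k : ℕ, LinearMap.range (ρ (tp ^ k))) := by
  have h₁ := fsuPart_le_iInf_range R J ρ
  have h₂ : ⨅ t : H, LinearMap.range (ρ t) ≤ ⨅ k : ℕ, LinearMap.range (ρ (tp ^ k)) :=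
    le_iInf fun k => iInf_le _ (tp ^ k)
  have h₃ : ⨅ k : ℕ, LinearMap.range (ρ (tp ^ k)) ≤ fsuPart R J ρ :=
    le_sSup (isFinSurjSub_iInf_range_pow ρ hdom)
  exact ⟨h₁.antisymm (h₂.trans h₃), (h₁.trans h₂).antisymm h₃⟩
end

section
/- Let M be a finitely generated module over a commutative Noetherian ring and f : M → M a module endomorphism. Then f maps the submodule ⋂_{k ≥ 0} fᵏ(M) bijectively onto itself. -/
open Polynomial in
/-- Krull's intersection theorem for `M` viewed as an `R[X]`-module through `f`. -/
theorem exists_aeval_apply_eq_self_of_mem_iInf_range_pow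
    {R : Type*} [CommRing R] [IsNoetherianRing R]
    {M : Type*} [AddCommGroup M] [Module R M] [Module.Finite R M]
    (f : Module.End R M) {x : M} (hx : x ∈ ⨅ k : ℕ, LinearMap.range (f ^ k)) :
    ∃ p : R[X], aeval f p (f x) = x := by
  have hmem : Module.AEval'.of f x ∈
      (⨅ i : ℕ, (Ideal.span {(X : R[X])}) ^ i • ⊤ : Submodule R[X] (Module.AEval' f)) := by
    rw [Submodule.mem_iInf] at hx ⊢
    intro i
    obtain ⟨y, rfl⟩ := hx i
    rw [← Module.End.smul_def, ← Module.AEval'.X_pow_smul_of]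
    exact Submodule.smul_mem_smul (Ideal.pow_mem_pow (Ideal.mem_span_singleton_self X) i) trivial
  obtain ⟨⟨q, hq⟩, hqx⟩ := (Ideal.mem_iInf_smul_pow_eq_bot_iff _ _).1 hmem
  obtain ⟨p, rfl⟩ := Ideal.mem_span_singleton'.1 hq
  refine ⟨p, (Module.AEval'.of f).injective ?_⟩
  rw [mul_smul, Module.AEval'.X_smul_of] at hqx
  exact (Module.AEval.of_aeval_smul f p (f x)).trans hqx

/-- An endomorphism commuting with `f` preserves the intersection of the images of the iterates
of `f`. -/
theorem Commute.apply_mem_iInf_range_pow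
    {R : Type*} [Semiring R] {M : Type*} [AddCommMonoid M] [Module R M]
    {f g : Module.End R M} (h : Commute g f) {x : M}
    (hx : x ∈ ⨅ k : ℕ, LinearMap.range (f ^ k)) :
    g x ∈ ⨅ k : ℕ, LinearMap.range (f ^ k) := by
  rw [Submodule.mem_iInf] at hx ⊢
  intro k
  obtain ⟨y, rfl⟩ := hx k
  exact ⟨g y, (LinearMap.congr_fun (h.pow_right k).eq y).symm⟩

/-- Let `M` be a finitely generated module over a commutative Noetherian ring `R` and
`f : M → M` a module endomorphism.  Then `f` maps the submodule `⋂_{k ≥ 0} fᵏ(M)` bijectively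
onto itself. -/
theorem bijOn_iInf_range_pow
    (R : Type*) [CommRing R] [IsNoetherianRing R]
    (M : Type*) [AddCommGroup M] [Module R M] [Module.Finite R M]
    (f : M →ₗ[R] M) :
    Set.BijOn ⇑f
      ↑(⨅ k : ℕ, LinearMap.range ((f ^ k : Module.End R M)))
      ↑(⨅ k : ℕ, LinearMap.range ((f ^ k : Module.End R M))) := by
  refine ⟨fun x hx ↦ (Commute.refl f).apply_mem_iInf_range_pow hx, fun x hx y hy hxy ↦ ?_,
    fun x hx ↦ ?_⟩
  · obtain ⟨p, hp⟩ := exists_aeval_apply_eq_self_of_mem_iInf_range_pow f (sub_mem hx hy)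
    rw [map_sub, hxy, sub_self, map_zero] at hp
    exact sub_eq_zero.1 hp.symm
  · obtain ⟨p, hp⟩ := exists_aeval_apply_eq_self_of_mem_iInf_range_pow f hx
    have hcomm : Commute (Polynomial.aeval f p) f := by
      simpa using (Commute.all p Polynomial.X).map (Polynomial.aeval f)
    exact ⟨Polynomial.aeval f p x, hcomm.apply_mem_iInf_range_pow hx,
      (LinearMap.congr_fun hcomm.eq x).symm.trans hp⟩
end

section
/- Assume R is Artinian and H⁺ has a dominating element. Let 0 → J₁ → J₂ → J₃ → 0 be a short exact sequence of R[H⁺]-modules (with R-linear H⁺-equivariant maps), each finitely generated as an R-module. Then the induced sequence 0 → (J₁)_fsu → (J₂)_fsu → (J₃)_fsu → 0 is also exact. -/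
/-- If `tp` is dominating and `J` is both Noetherian and Artinian, the finitely surjective part is
the stable range of the powers of `tp`. -/
theorem eventually_fsuPart_eq_range {R : Type*} [CommRing R] {H : Type*} [CommMonoid H]
    {J : Type*} [AddCommGroup J] [Module R J] [IsNoetherian R J] [IsArtinian R J]
    (ρ : H →* Module.End R J) {tp : H} (htp : Dominating tp) :
    ∀ᶠ n in Filter.atTop, fsuPart R J ⇑ρ = LinearMap.range (ρ (tp ^ n)) := by
  have hst := (ρ tp).eventually_iInf_range_pow_eq
  obtain ⟨n₀, h⟩ := Filter.eventually_atTop.1 hst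
  filter_upwards [Filter.eventually_ge_atTop n₀] with n hn
  apply le_antisymm
  · refine sSup_le fun N hN x hx => ?_
    obtain ⟨y, -, hy⟩ := hN.2.2 (tp ^ n) x hx
    exact ⟨y, hy⟩
  · refine le_sSup ⟨IsNoetherian.noetherian _, ?_, ?_⟩
    · rintro t _ ⟨y, rfl⟩
      refine ⟨ρ t y, ?_⟩
      rw [← Module.End.mul_apply, ← Module.End.mul_apply, ← map_mul, ← map_mul, mul_comm]
    · rintro t x hx
      obtain ⟨K, hK⟩ := htp t
      obtain ⟨s, hs⟩ := hK K le_rfl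
      rw [map_pow, ← h n hn, h (n + K) (by lia), ← map_pow] at hx
      obtain ⟨z, rfl⟩ := hx
      refine ⟨ρ (tp ^ n) (ρ s z), ⟨_, rfl⟩, ?_⟩
      simp only [← Module.End.mul_apply, ← map_mul]
      rw [pow_add, hs, mul_left_comm]

/-- Assume `R` is Artinian and the commutative monoid `H⁺` has a dominating element.  Let
`0 → J₁ → J₂ → J₃ → 0` be a short exact sequence of `R[H⁺]`-modules (with `R`-linear
`H⁺`-equivariant maps), each finitely generated as an `R`-module.  Then the induced sequence
`0 → (J₁)_fsu → (J₂)_fsu → (J₃)_fsu → 0` is also exact: `f` is injective on `(J₁)_fsu`,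
the image of `(J₁)_fsu` under `f` is exactly the part of `(J₂)_fsu` killed by `g`, and
`g` maps `(J₂)_fsu` onto `(J₃)_fsu`. -/
theorem fsuPart_shortExact
    (R : Type*) [CommRing R] [IsNoetherianRing R] [IsArtinianRing R]
    {H : Type*} [CommMonoid H]
    (J₁ J₂ J₃ : Type*)
    [AddCommGroup J₁] [Module R J₁] [AddCommGroup J₂] [Module R J₂]
    [AddCommGroup J₃] [Module R J₃]
    [Module.Finite R J₁] [Module.Finite R J₂] [Module.Finite R J₃]
    (ρ₁ : H →* Module.End R J₁) (ρ₂ : H →* Module.End R J₂) (ρ₃ : H →* Module.End R J₃)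
    (f : J₁ →ₗ[R] J₂) (g : J₂ →ₗ[R] J₃)
    (hf : Function.Injective ⇑f) (hg : Function.Surjective ⇑g)
    (hexact : LinearMap.range f = LinearMap.ker g)
    (hfe : ∀ (t : H) (x : J₁), f (ρ₁ t x) = ρ₂ t (f x))
    (hge : ∀ (t : H) (x : J₂), g (ρ₂ t x) = ρ₃ t (g x))
    (hdom : ∃ tp : H, Dominating tp) :
    Set.InjOn ⇑f ↑(fsuPart R J₁ ⇑ρ₁) ∧
    Submodule.map f (fsuPart R J₁ ⇑ρ₁) = fsuPart R J₂ ⇑ρ₂ ⊓ LinearMap.ker g ∧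
    Submodule.map g (fsuPart R J₂ ⇑ρ₂) = fsuPart R J₃ ⇑ρ₃ := by
  obtain ⟨tp, htp⟩ := hdom
  obtain ⟨n, ⟨⟨h₁, h₂⟩, h₃, hker⟩, h₂'⟩ :=
    (((eventually_fsuPart_eq_range ρ₁ htp).and (eventually_fsuPart_eq_range ρ₂ htp)).and
      ((eventually_fsuPart_eq_range ρ₃ htp).and
        (ρ₃ tp).eventually_iSup_ker_pow_eq)).and
      (Filter.eventually_forall_ge_atTop.2 (eventually_fsuPart_eq_range ρ₂ htp)) |>.exists
  refine ⟨hf.injOn, le_antisymm ?_ ?_, ?_⟩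
  · rw [h₁, h₂]
    rintro _ ⟨_, ⟨y, rfl⟩, rfl⟩
    exact ⟨⟨f y, (hfe _ y).symm⟩, hexact.le ⟨_, rfl⟩⟩
  · rintro x ⟨hx, hgx⟩
    rw [SetLike.mem_coe, h₂' (n + n) (by lia)] at hx
    obtain ⟨z, rfl⟩ := hx
    have hz : g z ∈ LinearMap.ker (ρ₃ tp ^ n) := by
      rw [← hker]
      refine le_iSup (fun m => LinearMap.ker (ρ₃ tp ^ m)) (n + n) ?_
      rw [LinearMap.mem_ker, ← map_pow, ← hge]
      exact hgx
    have hz' : ρ₂ (tp ^ n) z ∈ LinearMap.range f := by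
      rw [hexact, LinearMap.mem_ker, hge, map_pow]
      exact hz
    obtain ⟨w, hw⟩ := hz'
    refine ⟨ρ₁ (tp ^ n) w, h₁ ▸ ⟨w, rfl⟩, ?_⟩
    rw [hfe, hw, pow_add, map_mul, Module.End.mul_apply]
  · rw [h₂, h₃]
    ext x
    constructor
    · rintro ⟨_, ⟨y, rfl⟩, rfl⟩
      exact ⟨g y, (hge _ y).symm⟩
    · rintro ⟨y, rfl⟩
      obtain ⟨y, rfl⟩ := hg y
      exact ⟨_, ⟨y, rfl⟩, hge _ y⟩
end

section
/- Assume H⁺ has a dominating element. Let 0 → J₁ → J₂ → J₃ → 0 be a short exact sequence of O[H⁺]-modules (with O-linear H⁺-equivariant maps), each finitely generated as an O-module. Then the induced sequence 0 → (J₁)_fsu → (J₂)_fsu → (J₃)_fsu → 0 is also exact. -/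
/-- The ring of integers `O` of a finite extension `E` of `ℚ_p`: the integral closure
(equivalently, the valuation ring) of `ℤ_p` in `E`. -/
abbrev PadicROI (p : ℕ) [Fact p.Prime] (E : Type*) [Field E] [Algebra ℤ_[p] E] : Type _ :=
  ↥(integralClosure ℤ_[p] E)

/-- Over `ℤ_[p]`, every submodule of a finite free module is closed. -/
theorem PadicInt.isClosed_submodule_pi {p : ℕ} [Fact p.Prime] {m : ℕ}
    (K : Submodule ℤ_[p] (Fin m → ℤ_[p])) : IsClosed (K : Set (Fin m → ℤ_[p])) := by
  obtain ⟨k, q, hq⟩ := Module.Finite.exists_fin' ℤ_[p] K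
  have hcont : Continuous (K.subtype ∘ₗ q) := LinearMap.continuous_on_pi _
  have hrange : Set.range (K.subtype ∘ₗ q) = (K : Set (Fin m → ℤ_[p])) := by
    rw [← LinearMap.coe_range, LinearMap.range_comp, LinearMap.range_eq_top.mpr hq,
      Submodule.map_top, Submodule.range_subtype]
  rw [← hrange]
  exact (isCompact_range hcont).isClosed

/-- Linear compactness: for finite modules over a finite `ℤ_[p]`-algebra, taking images commutes
with decreasing intersections of submodules. -/
theorem PadicInt.map_iInf_of_antitone {p : ℕ} [Fact p.Prime] {R : Type*} [CommRing R]
    [Algebra ℤ_[p] R] [Module.Finite ℤ_[p] R] {M M' : Type*} [AddCommGroup M] [Module R M]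
    [Module.Finite R M] [AddCommGroup M'] [Module R M'] (φ : M →ₗ[R] M')
    {N : ℕ → Submodule R M} (hN : Antitone N) :
    Submodule.map φ (⨅ n, N n) = ⨅ n, Submodule.map φ (N n) := by
  refine le_antisymm (le_iInf fun n => Submodule.map_mono (iInf_le N n)) fun x hx => ?_
  let : Module ℤ_[p] M := Module.compHom M (algebraMap ℤ_[p] R)
  have : IsScalarTower ℤ_[p] R M := IsScalarTower.of_algebraMap_smul fun _ _ => rfl
  have : Module.Finite ℤ_[p] M := Module.Finite.trans R M
  obtain ⟨m, q, hq⟩ := Module.Finite.exists_fin' ℤ_[p] M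
  let C : ℕ → Set (Fin m → ℤ_[p]) := fun n => {z | q z ∈ N n ∧ φ (q z) = x}
  have hne : ∀ n, (C n).Nonempty := fun n => by
    obtain ⟨y, hy, hyx⟩ := (Submodule.mem_iInf _).mp hx n
    obtain ⟨z, rfl⟩ := hq y
    exact ⟨z, hy, hyx⟩
  have hcl : ∀ n, IsClosed (C n) := fun n => by
    obtain ⟨z₀, hz₀, hz₀x⟩ := hne n
    let K := ((N n ⊓ LinearMap.ker φ).restrictScalars ℤ_[p]).comap q
    have hC : C n = (fun z => z - z₀) ⁻¹' (K : Set (Fin m → ℤ_[p])) := by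
      ext z
      simp only [C, K, Set.mem_ofPred_eq, Set.mem_preimage, SetLike.mem_coe, Submodule.mem_comap,
        Submodule.restrictScalars_mem, Submodule.mem_inf, LinearMap.mem_ker, map_sub,
        sub_eq_zero, hz₀x, Submodule.sub_mem_iff_left _ hz₀]
    rw [hC]
    exact (PadicInt.isClosed_submodule_pi K).preimage (continuous_id.sub continuous_const)
  obtain ⟨z, hz⟩ := IsCompact.nonempty_iInter_of_sequence_nonempty_isCompact_isClosed C
    (fun n z hz => ⟨hN n.le_succ hz.1, hz.2⟩) hne (hcl 0).isCompact hcl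
  rw [Set.mem_iInter] at hz
  exact ⟨q z, (Submodule.mem_iInf _).mpr fun n => (hz n).1, (hz 0).2⟩

section FinSurj

variable {R : Type*} [CommRing R] {H : Type*} [CommMonoid H]
  {J : Type*} [AddCommGroup J] [Module R J]

theorem LinearMap.antitone_range_pow (T : Module.End R J) :
    Antitone fun n : ℕ => LinearMap.range (T ^ n) := by
  refine antitone_nat_of_succ_le fun n => ?_
  rw [pow_succ]
  exact LinearMap.range_comp_le_range T (T ^ n)

/-- For a stable finitely generated submodule, surjectivity of a dominating element implies
surjectivity of the whole monoid. -/
theorem IsFinSurjSub.of_dominating {ρ : H →* Module.End R J} {tp : H} (htp : Dominating tp)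
    {N : Submodule R J} (hfg : N.FG) (hstab : ∀ t : H, ∀ x ∈ N, ρ t x ∈ N)
    (hsurj : N ≤ N.map (ρ tp)) : IsFinSurjSub R ρ N := by
  refine ⟨hfg, hstab, fun t x hx => ?_⟩
  have hpow : ∀ k : ℕ, N ≤ N.map (ρ tp ^ k) := fun k => by
    induction k with
    | zero => exact (Submodule.map_id N).ge
    | succ k ih =>
      rw [pow_succ', Module.End.mul_eq_comp, Submodule.map_comp]
      exact hsurj.trans (Submodule.map_mono ih)
  obtain ⟨k, hk⟩ := htp t
  obtain ⟨s, hs⟩ := hk k le_rfl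
  obtain ⟨y, hy, rfl⟩ := hpow k hx
  refine ⟨ρ s y, hstab s y hy, ?_⟩
  rw [← map_pow, hs, map_mul, Module.End.mul_apply]

theorem IsFinSurjSub.le_range_pow {ρ : H →* Module.End R J} {N : Submodule R J}
    (hN : IsFinSurjSub R ρ N) (t : H) (n : ℕ) : N ≤ LinearMap.range (ρ t ^ n) := fun x hx => by
  obtain ⟨y, -, hy⟩ := hN.2.2 (t ^ n) x hx
  exact ⟨y, by rw [← map_pow, hy]⟩

/-- An endomorphism which maps the Noetherian submodule `M` onto itself and preserves `N ≤ M` maps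
`N` onto itself. -/
theorem LinearMap.le_map_of_surjOn [IsNoetherianRing R] {T : Module.End R J}
    {M N : Submodule R J} [Module.Finite R M] (hM : ∀ x ∈ M, T x ∈ M)
    (hsurj : ∀ x ∈ M, ∃ y ∈ M, T y = x) (hNM : N ≤ M) (hN : ∀ x ∈ N, T x ∈ N) :
    N ≤ N.map T := by
  let S : Module.End R M := T.restrict hM
  have hS : Function.Surjective S := fun x => by
    obtain ⟨y, hy, hyx⟩ := hsurj x x.2
    exact ⟨⟨y, hy⟩, Subtype.ext hyx⟩
  let L : Submodule R M := N.comap M.subtype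
  have hSL : ∀ x ∈ L, S x ∈ L := fun x hx => hN x hx
  let chain : ℕ →o Submodule R M := ⟨fun n => L.comap (S ^ n), monotone_nat_of_le_succ
    fun n x hx => by
      rw [Submodule.mem_comap, pow_succ', Module.End.mul_apply]
      exact hSL _ hx⟩
  obtain ⟨n, hn⟩ := monotone_stabilizes_iff_noetherian.mpr (inferInstance : IsNoetherian R M) chain
  intro x hx
  have hSn : Function.Surjective (S ^ (n + 1)) := by
    rw [Module.End.coe_pow]
    exact hS.iterate _
  obtain ⟨z, hz⟩ := hSn ⟨x, hNM hx⟩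
  have hmem : z ∈ chain n := by
    rw [hn (n + 1) n.le_succ]
    change (S ^ (n + 1)) z ∈ L
    rw [hz]
    exact hx
  refine ⟨((S ^ n) z : M), hmem, ?_⟩
  have := congrArg Subtype.val hz
  rwa [pow_succ', Module.End.mul_apply] at this

/-- The finitely surjective part is the stable range of a dominating element. -/
theorem fsuPart_eq_iInf_range_s7 {p : ℕ} [Fact p.Prime] [Algebra ℤ_[p] R] [Module.Finite ℤ_[p] R]
    [Module.Finite R J] (ρ : H →* Module.End R J) {tp : H} (htp : Dominating tp) :
    IsFinSurjSub R ρ (⨅ n : ℕ, LinearMap.range (ρ tp ^ n)) ∧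
      fsuPart R J ρ = ⨅ n : ℕ, LinearMap.range (ρ tp ^ n) := by
  have : IsNoetherianRing R := IsNoetherianRing.of_finite ℤ_[p] R
  have key : IsFinSurjSub R ρ (⨅ n : ℕ, LinearMap.range (ρ tp ^ n)) := by
    refine .of_dominating htp (IsNoetherian.noetherian _) (fun t x hx => ?_) ?_
    · refine (Submodule.mem_iInf _).mpr fun n => ?_
      obtain ⟨y, rfl⟩ := (Submodule.mem_iInf _).mp hx n
      refine ⟨ρ t y, ?_⟩
      rw [← map_pow, ← Module.End.mul_apply, ← Module.End.mul_apply, ← map_mul, ← map_mul,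
        mul_comm]
    · rw [PadicInt.map_iInf_of_antitone (p := p) _ (LinearMap.antitone_range_pow _)]
      refine le_iInf fun n => (iInf_le _ (n + 1)).trans ?_
      rw [pow_succ', Module.End.mul_eq_comp, LinearMap.range_comp]
  exact ⟨key, le_antisymm (sSup_le fun N hN => le_iInf fun n => hN.le_range_pow tp n)
    (le_sSup key)⟩

end FinSurj

/-- Let `O` be the ring of integers of a finite extension `E` of `ℚ_p`, and assume the commutative
monoid `H⁺` has a dominating element.  Let `0 → J₁ → J₂ → J₃ → 0` be a short exact sequence of
`O[H⁺]`-modules (with `O`-linear `H⁺`-equivariant maps), each finitely generated as an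
`O`-module.  Then the induced sequence `0 → (J₁)_fsu → (J₂)_fsu → (J₃)_fsu → 0` is also exact. -/
theorem fsuPart_shortExact_padic
    (p : ℕ) [Fact p.Prime] (E : Type*) [Field E]
    [Algebra ℚ_[p] E] [FiniteDimensional ℚ_[p] E]
    [Algebra ℤ_[p] E] [IsScalarTower ℤ_[p] ℚ_[p] E]
    {H : Type*} [CommMonoid H]
    (J₁ J₂ J₃ : Type*)
    [AddCommGroup J₁] [Module (PadicROI p E) J₁]
    [AddCommGroup J₂] [Module (PadicROI p E) J₂]
    [AddCommGroup J₃] [Module (PadicROI p E) J₃]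
    [Module.Finite (PadicROI p E) J₁] [Module.Finite (PadicROI p E) J₂]
    [Module.Finite (PadicROI p E) J₃]
    (ρ₁ : H →* Module.End (PadicROI p E) J₁) (ρ₂ : H →* Module.End (PadicROI p E) J₂)
    (ρ₃ : H →* Module.End (PadicROI p E) J₃)
    (f : J₁ →ₗ[PadicROI p E] J₂) (g : J₂ →ₗ[PadicROI p E] J₃)
    (hf : Function.Injective ⇑f) (hg : Function.Surjective ⇑g)
    (hexact : LinearMap.range f = LinearMap.ker g)
    (hfe : ∀ (t : H) (x : J₁), f (ρ₁ t x) = ρ₂ t (f x))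
    (hge : ∀ (t : H) (x : J₂), g (ρ₂ t x) = ρ₃ t (g x))
    (hdom : ∃ tp : H, Dominating tp) :
    Set.InjOn ⇑f ↑(fsuPart (PadicROI p E) J₁ ⇑ρ₁) ∧
    Submodule.map f (fsuPart (PadicROI p E) J₁ ⇑ρ₁)
      = fsuPart (PadicROI p E) J₂ ⇑ρ₂ ⊓ LinearMap.ker g ∧
    Submodule.map g (fsuPart (PadicROI p E) J₂ ⇑ρ₂) = fsuPart (PadicROI p E) J₃ ⇑ρ₃ := by
  obtain ⟨tp, htp⟩ := hdom
  have : Module.Finite ℤ_[p] (PadicROI p E) :=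
    IsIntegralClosure.finite ℤ_[p] ℚ_[p] E (integralClosure ℤ_[p] E)
  have : IsNoetherianRing (PadicROI p E) :=
    IsNoetherianRing.of_finite ℤ_[p] (PadicROI p E)
  obtain ⟨-, h₁⟩ := fsuPart_eq_iInf_range_s7 (p := p) ρ₁ htp
  obtain ⟨fs₂, h₂⟩ := fsuPart_eq_iInf_range_s7 (p := p) ρ₂ htp
  obtain ⟨-, h₃⟩ := fsuPart_eq_iInf_range_s7 (p := p) ρ₃ htp
  have hf_pow : ∀ (n : ℕ) (x : J₁), f ((ρ₁ tp ^ n) x) = (ρ₂ tp ^ n) (f x) := fun n x => by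
    rw [← map_pow, ← map_pow, hfe]
  have hg_pow : ∀ n : ℕ, Submodule.map g (LinearMap.range (ρ₂ tp ^ n))
      = LinearMap.range (ρ₃ tp ^ n) := fun n => by
    have hcomm : g ∘ₗ (ρ₂ tp ^ n) = (ρ₃ tp ^ n) ∘ₗ g := LinearMap.ext fun x => by
      simp only [LinearMap.comp_apply, ← map_pow, hge]
    rw [← LinearMap.range_comp, hcomm, LinearMap.range_comp, LinearMap.range_eq_top.mpr hg,
      Submodule.map_top]
  refine ⟨hf.injOn, le_antisymm (le_inf ?_ ?_) ?_, ?_⟩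
  · rw [h₁, h₂]
    rintro _ ⟨x, hx, rfl⟩
    refine (Submodule.mem_iInf _).mpr fun n => ?_
    obtain ⟨y, rfl⟩ := (Submodule.mem_iInf _).mp hx n
    exact ⟨f y, (hf_pow n y).symm⟩
  · rw [← hexact]
    exact LinearMap.map_le_range
  · rw [h₂]
    set M := ⨅ n : ℕ, LinearMap.range (ρ₂ tp ^ n)
    have hstab : ∀ t : H, ∀ x ∈ M ⊓ LinearMap.ker g, ρ₂ t x ∈ M ⊓ LinearMap.ker g :=
      fun t x hx => ⟨fs₂.2.1 t x hx.1, by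
        rw [SetLike.mem_coe, LinearMap.mem_ker, hge, LinearMap.mem_ker.mp hx.2, map_zero]⟩
    have hmap : M ⊓ LinearMap.ker g ≤ (M ⊓ LinearMap.ker g).map (ρ₂ tp) :=
      LinearMap.le_map_of_surjOn (fs₂.2.1 tp) (fs₂.2.2 tp) inf_le_left (hstab tp)
    have hfs : IsFinSurjSub (PadicROI p E) ρ₁ ((M ⊓ LinearMap.ker g).comap f) := by
      refine .of_dominating htp (IsNoetherian.noetherian _) (fun t x hx => ?_) fun x hx => ?_
      · rw [Submodule.mem_comap, hfe]
        exact hstab t _ hx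
      · obtain ⟨y, hy, hyx⟩ := hmap hx
        obtain ⟨z, rfl⟩ : y ∈ LinearMap.range f := hexact ▸ hy.2
        exact ⟨z, hy, hf (by rw [hfe, hyx])⟩
    intro x hx
    obtain ⟨z, rfl⟩ : x ∈ LinearMap.range f := hexact ▸ hx.2
    exact ⟨z, (le_sSup hfs : _ ≤ fsuPart (PadicROI p E) J₁ ρ₁) hx, rfl⟩
  · rw [h₂, h₃, PadicInt.map_iInf_of_antitone (p := p) g (LinearMap.antitone_range_pow _)]
    exact iInf_congr hg_pow
end

section
/- Assume H⁺ has a dominating element t₊. Let J be an O[H⁺]-module which is finitely generated as an O-module. Then there is a decomposition J = J_fsu ⊕ J' into H⁺-stable O-submodules such that every t ∈ H⁺ acts bijectively on J_fsu and t₊ acts topologically nilpotently on J', i.e., for every x ∈ J' and every m ≥ 0 there exists k ≥ 0 with t₊ᵏ·x ∈ pᵐJ'. -/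
set_option synthInstance.maxHeartbeats 1000000
set_option maxHeartbeats 1000000

/-- The subgroup `pᵐM` of an abelian group `M`. -/
def primePowMultiples (p : ℕ) (M : Type*) [AddCommGroup M] (m : ℕ) : AddSubgroup M :=
  (nsmulAddMonoidHom (p ^ m) : M →+ M).range

section PrimePowMultiples

variable {p : ℕ} {M : Type*} [AddCommGroup M]

theorem mem_primePowMultiples {m : ℕ} {x : M} :
    x ∈ primePowMultiples p M m ↔ ∃ z, p ^ m • z = x := Iff.rfl

theorem map_mem_primePowMultiples {R : Type*} [Ring R] [Module R M] (f : Module.End R M)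
    {m : ℕ} {x : M} (hx : x ∈ primePowMultiples p M m) : f x ∈ primePowMultiples p M m := by
  obtain ⟨z, rfl⟩ := hx
  exact ⟨f z, by simp⟩

/-- `M` is Hausdorff and complete for the `p`-adic topology, with finite quotients `M / pᵐM`. -/
structure IsPadicProfinite (p : ℕ) (M : Type*) [AddCommGroup M] : Prop where
  haus : ∀ x : M, (∀ m, x ∈ primePowMultiples p M m) → x = 0
  prec : ∀ s : ℕ → M, (∀ m, s (m + 1) - s m ∈ primePowMultiples p M m) →
    ∃ L, ∀ m, s m - L ∈ primePowMultiples p M m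
  finite_quotient : ∀ m, Finite (M ⧸ primePowMultiples p M m)

end PrimePowMultiples

section PowLim

open Nat

variable {p : ℕ} {R M : Type*} [Ring R] [AddCommGroup M] [Module R M]

theorem exists_pow_factorial_congr (hfin : ∀ m, Finite (M ⧸ primePowMultiples p M m))
    (f : Module.End R M) (m : ℕ) :
    ∃ N, ∀ k ≥ N, ∀ x, (f ^ k !) x - (f ^ N !) x ∈ primePowMultiples p M m ∧
      (f ^ k !) ((f ^ k !) x) - (f ^ k !) x ∈ primePowMultiples p M m := by
  have := hfin m
  have : Finite ((M ⧸ primePowMultiples p M m) →+ (M ⧸ primePowMultiples p M m)) :=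
    DFunLike.finite _
  let g (n : ℕ) : (M ⧸ primePowMultiples p M m) →+ (M ⧸ primePowMultiples p M m) :=
    QuotientAddGroup.map _ _ ((f ^ n).toAddMonoidHom) fun x hx => map_mem_primePowMultiples _ hx
  obtain ⟨a, d, hd, hg⟩ : ∃ a d, 0 < d ∧ g (a + d) = g a := by
    obtain ⟨a, b, hab, h⟩ := Finite.exists_ne_map_eq_of_infinite g
    rcases lt_or_gt_of_ne hab with hlt | hlt
    · exact ⟨a, b - a, by omega, by rw [h]; congr 1; omega⟩
    · exact ⟨b, a - b, by omega, by rw [← h]; congr 1; omega⟩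
  have base (x : M) : (f ^ (a + d)) x - (f ^ a) x ∈ primePowMultiples p M m := by
    have := DFunLike.congr_fun hg (x : M ⧸ primePowMultiples p M m)
    exact QuotientAddGroup.eq_iff_sub_mem.mp this
  have step (n : ℕ) (hn : a ≤ n) (j : ℕ) (x : M) :
      (f ^ (n + d * j)) x - (f ^ n) x ∈ primePowMultiples p M m := by
    induction j with
    | zero => simp [zero_mem]
    | succ j ih =>
      have h := map_mem_primePowMultiples (f ^ (n - a + d * j)) (base x)
      rw [map_sub, ← Module.End.mul_apply, ← Module.End.mul_apply, ← pow_add, ← pow_add] at h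
      convert add_mem h ih using 1
      rw [show n - a + d * j + (a + d) = n + d * (j + 1) by rw [mul_add]; omega,
        show n - a + d * j + a = n + d * j by omega]
      abel
  have le_fact (k : ℕ) (hk : a + d ≤ k) : a ≤ k ! :=
    le_trans (by omega) (Nat.self_le_factorial k)
  refine ⟨a + d, fun k hk x => ⟨?_, ?_⟩⟩
  · obtain ⟨j, hj⟩ : d ∣ (k !) - (a + d)! :=
      Nat.dvd_sub (Nat.dvd_factorial hd (by omega)) (Nat.dvd_factorial hd (by omega))
    have hle := Nat.factorial_le hk
    rw [show k ! = (a + d)! + d * j by omega]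
    exact step _ (le_fact _ le_rfl) j x
  · obtain ⟨j, hj⟩ : d ∣ k ! := Nat.dvd_factorial hd (by omega)
    have := step _ (le_fact k hk) j x
    rwa [← hj, pow_add, Module.End.mul_apply] at this

/-- `y` is the `p`-adic limit of the sequence `f^{k!} x`. -/
def PowLim (p : ℕ) (f : Module.End R M) (x y : M) : Prop :=
  ∀ m, ∃ N, ∀ k ≥ N, (f ^ k !) x - y ∈ primePowMultiples p M m

variable {f : Module.End R M}

theorem PowLim.unique (hM : IsPadicProfinite p M) {x y z : M} (hy : PowLim p f x y)
    (hz : PowLim p f x z) : y = z := by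
  rw [← sub_eq_zero]
  refine hM.haus _ fun m => ?_
  obtain ⟨N, hN⟩ := hy m
  obtain ⟨K, hK⟩ := hz m
  convert sub_mem (hK (max N K) (le_max_right _ _)) (hN (max N K) (le_max_left _ _)) using 1
  abel

theorem PowLim.add {x y x' y' : M} (h : PowLim p f x y) (h' : PowLim p f x' y') :
    PowLim p f (x + x') (y + y') := fun m => by
  obtain ⟨N, hN⟩ := h m
  obtain ⟨K, hK⟩ := h' m
  refine ⟨max N K, fun k hk => ?_⟩
  convert add_mem (hN k (le_of_max_le_left hk)) (hK k (le_of_max_le_right hk)) using 1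
  rw [map_add]
  abel

theorem PowLim.map {x y : M} (h : PowLim p f x y) {g : Module.End R M} (hg : Commute g f) :
    PowLim p f (g x) (g y) := fun m => by
  obtain ⟨N, hN⟩ := h m
  refine ⟨N, fun k hk => ?_⟩
  have := map_mem_primePowMultiples g (hN k hk)
  rwa [map_sub, ← Module.End.mul_apply, (hg.pow_right _).eq, Module.End.mul_apply] at this

theorem PowLim.neg {x y : M} (h : PowLim p f x y) : PowLim p f (-x) (-y) := by
  simpa using h.map (g := -1) (Commute.neg_one_left f)

theorem PowLim.sub {x y x' y' : M} (h : PowLim p f x y) (h' : PowLim p f x' y') :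
    PowLim p f (x - x') (y - y') := by
  simpa only [sub_eq_add_neg] using h.add h'.neg

theorem PowLim.zero : PowLim p f 0 0 := fun m => ⟨0, fun k _ => by simp [zero_mem]⟩

theorem PowLim.smul {R : Type*} [CommRing R] [Module R M] {f : Module.End R M} (r : R) {x y : M}
    (h : PowLim p f x y) : PowLim p f (r • x) (r • y) := by
  simpa using h.map (g := algebraMap R (Module.End R M) r) (Algebra.commutes r f)

theorem exists_powLim (hM : IsPadicProfinite p M) (f : Module.End R M) (x : M) :
    ∃ y, PowLim p f x y := by
  choose N hN using exists_pow_factorial_congr hM.finite_quotient f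
  let K (m : ℕ) : ℕ := ∑ i ∈ Finset.range (m + 1), N i
  have hK (m : ℕ) : N m ≤ K m :=
    Finset.single_le_sum (f := N) (fun _ _ => Nat.zero_le _) (Finset.self_mem_range_succ m)
  have hKs (m : ℕ) : K m ≤ K (m + 1) := by
    simp only [K, Finset.sum_range_succ _ (m + 1)]
    omega
  have key (m k l : ℕ) (hk : N m ≤ k) (hl : N m ≤ l) :
      (f ^ k !) x - (f ^ l !) x ∈ primePowMultiples p M m := by
    simpa using sub_mem (hN m k hk x).1 (hN m l hl x).1
  obtain ⟨L, hL⟩ := hM.prec (fun m => (f ^ (K m)!) x)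
    fun m => key m _ _ ((hK m).trans (hKs m)) (hK m)
  refine ⟨L, fun m => ⟨N m, fun k hk => ?_⟩⟩
  simpa using add_mem (key m k (K m) hk (hK m)) (hL m)

theorem PowLim.idem (hM : IsPadicProfinite p M) {x y : M} (h : PowLim p f x y) :
    PowLim p f y y := fun m => by
  obtain ⟨N, hN⟩ := h m
  obtain ⟨K, hK⟩ := exists_pow_factorial_congr hM.finite_quotient f m
  refine ⟨max N K, fun k hk => ?_⟩
  have h1 := hN k (le_of_max_le_left hk)
  have h2 := (hK k (le_of_max_le_right hk) x).2
  have h3 := map_mem_primePowMultiples (f ^ k !) h1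
  convert add_mem (sub_mem h2 h3) h1 using 1
  rw [map_sub]
  abel

theorem PowLim.self_of_surjOn (hM : IsPadicProfinite p M) {N : Submodule R M}
    (hN : ∀ x ∈ N, ∃ y ∈ N, f y = x) {x : M} (hx : x ∈ N) : PowLim p f x x := fun m => by
  have hpow (n : ℕ) : ∀ x ∈ N, ∃ y ∈ N, (f ^ n) y = x := by
    induction n with
    | zero => exact fun x hx => ⟨x, hx, by simp⟩
    | succ n ih =>
      intro x hx
      obtain ⟨y, hy, rfl⟩ := ih x hx
      obtain ⟨z, hz, rfl⟩ := hN y hy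
      exact ⟨z, hz, by rw [_root_.pow_succ, Module.End.mul_apply]⟩
  obtain ⟨K, hK⟩ := exists_pow_factorial_congr hM.finite_quotient f m
  refine ⟨K, fun k hk => ?_⟩
  obtain ⟨y, -, rfl⟩ := hpow k ! x hx
  exact (hK k hk y).2

end PowLim

section Decomposition

open Nat

variable {p : ℕ} {R M : Type*} [CommRing R] [AddCommGroup M] [Module R M]

/-- The elements fixed by the `p`-adic limit of `f^{k!}`. -/
def powLimFixed (p : ℕ) (f : Module.End R M) : Submodule R M where
  carrier := {x | PowLim p f x x}
  add_mem' := PowLim.add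
  zero_mem' := PowLim.zero
  smul_mem' r _ := PowLim.smul r

/-- The elements killed by the `p`-adic limit of `f^{k!}`. -/
def powLimKer (p : ℕ) (f : Module.End R M) : Submodule R M where
  carrier := {x | PowLim p f x 0}
  add_mem' hx hy := by simpa using PowLim.add hx hy
  zero_mem' := PowLim.zero
  smul_mem' r _ hx := by simpa using PowLim.smul r hx

variable {f : Module.End R M}

theorem isCompl_powLimFixed_powLimKer (hM : IsPadicProfinite p M) (f : Module.End R M) :
    IsCompl (powLimFixed p f) (powLimKer p f) := by
  refine ⟨Submodule.disjoint_def.mpr fun x h1 h2 => PowLim.unique hM h1 h2,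
    codisjoint_iff.mpr <| eq_top_iff.mpr fun x _ => ?_⟩
  obtain ⟨y, hy⟩ := exists_powLim hM f x
  refine Submodule.mem_sup.mpr ⟨y, hy.idem hM, x - y, ?_, by abel⟩
  have := hy.sub (hy.idem hM)
  rwa [sub_self] at this

theorem map_mem_powLimFixed {g : Module.End R M} (hg : Commute g f) {x : M}
    (hx : x ∈ powLimFixed p f) : g x ∈ powLimFixed p f :=
  PowLim.map hx hg

theorem map_mem_powLimKer {g : Module.End R M} (hg : Commute g f) {x : M}
    (hx : x ∈ powLimKer p f) : g x ∈ powLimKer p f := by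
  have := PowLim.map hx hg
  rwa [map_zero] at this

theorem exists_add_smul_of_mem_powLimFixed (hM : IsPadicProfinite p M) {x : M}
    (hx : x ∈ powLimFixed p f) :
    ∃ y ∈ powLimFixed p f, ∃ z ∈ powLimFixed p f, x = f y + (p : ℕ) • z := by
  obtain ⟨N, hN⟩ := hx 1
  obtain ⟨w, hw⟩ := hN N le_rfl
  obtain ⟨z, hz⟩ := exists_powLim hM f w
  refine ⟨(f ^ ((N !) - 1)) x, map_mem_powLimFixed ((Commute.refl f).pow_left _) hx,
    -z, neg_mem (hz.idem hM), ?_⟩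
  have hNx : (f ^ N !) x ∈ powLimFixed p f :=
    map_mem_powLimFixed ((Commute.refl f).pow_left _) hx
  have hlim : PowLim p f ((f ^ N !) x - x) (p • z) := by
    have := hz.map (g := (p : Module.End R M)) (Nat.cast_commute p f)
    simp only [nsmulAddMonoidHom_apply, pow_one] at hw
    rw [← hw]
    simpa using this
  have heq := PowLim.unique hM hlim (PowLim.sub hNx hx)
  rw [← Module.End.mul_apply, ← _root_.pow_succ', Nat.sub_add_cancel (Nat.factorial_pos N), smul_neg,
    heq]
  abel

theorem exists_mem_powLimKer_pow_apply_eq (hM : IsPadicProfinite p M) {x : M}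
    (hx : x ∈ powLimKer p f) (m : ℕ) :
    ∃ k, ∃ z ∈ powLimKer p f, (f ^ k) x = p ^ m • z := by
  obtain ⟨N, hN⟩ := hx m
  obtain ⟨w, hw⟩ := hN N le_rfl
  obtain ⟨y, hy⟩ := exists_powLim hM f w
  have hNx : (f ^ N !) x ∈ powLimKer p f := map_mem_powLimKer ((Commute.refl f).pow_left _) hx
  have hlim : PowLim p f ((f ^ N !) x) (p ^ m • y) := by
    have := hy.map (g := ((p ^ m : ℕ) : Module.End R M)) (Nat.cast_commute _ f)
    simp only [nsmulAddMonoidHom_apply, sub_zero] at hw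
    rw [← hw]
    simpa only [Module.End.natCast_apply] using this
  refine ⟨N !, w - y, ?_, ?_⟩
  · have := hy.sub (hy.idem hM)
    rwa [sub_self] at this
  · rw [smul_sub, PowLim.unique hM hlim hNx, sub_zero]
    simpa using hw.symm

end Decomposition

section PadicInt

variable {p : ℕ} [Fact p.Prime] {M : Type*} [AddCommGroup M] [Module ℤ_[p] M]

theorem PadicInt.exists_sum_sub_eq_pow_mul (a : ℕ → ℤ_[p]) :
    ∃ α : ℤ_[p], ∀ m, ∃ b, ∑ i ∈ Finset.range m, (p : ℤ_[p]) ^ i * a i - α = p ^ m * b := by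
  obtain ⟨α, hα⟩ := IsPrecomplete.prec' (I := IsLocalRing.maximalIdeal ℤ_[p])
    (fun m => ∑ i ∈ Finset.range m, (p : ℤ_[p]) ^ i * a i) fun {m n} hmn => by
      rw [SModEq.sub_mem, smul_eq_mul, Ideal.mul_top, PadicInt.maximalIdeal_eq_span_p,
        Ideal.span_singleton_pow, ← neg_mem_iff, neg_sub, Finset.sum_range_sub_sum_range hmn]
      refine sum_mem fun i hi => Ideal.mul_mem_right _ _ ?_
      exact Ideal.mem_span_singleton.mpr (pow_dvd_pow _ (Finset.mem_filter.mp hi).2)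
  refine ⟨α, fun m => ?_⟩
  have := hα m
  rwa [SModEq.sub_mem, smul_eq_mul, Ideal.mul_top, PadicInt.maximalIdeal_eq_span_p,
    Ideal.span_singleton_pow, Ideal.mem_span_singleton] at this

theorem PadicInt.mem_primePowMultiples_iff {m : ℕ} {x : M} :
    x ∈ primePowMultiples p M m ↔ ∃ z, (p : ℤ_[p]) ^ m • z = x := by
  simp [mem_primePowMultiples, ← Nat.cast_smul_eq_nsmul ℤ_[p]]

theorem PadicInt.mem_smul_top_iff {m : ℕ} {x : M} :
    x ∈ (IsLocalRing.maximalIdeal ℤ_[p] ^ m • ⊤ : Submodule ℤ_[p] M) ↔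
      x ∈ primePowMultiples p M m := by
  rw [PadicInt.mem_primePowMultiples_iff, PadicInt.maximalIdeal_eq_span_p,
    Ideal.span_singleton_pow, Submodule.ideal_span_singleton_smul,
    Submodule.mem_smul_pointwise_iff_exists]
  simp

/-- A finitely generated `ℤ_p`-module is profinite for its `p`-adic topology. -/
theorem PadicInt.isPadicProfinite [Module.Finite ℤ_[p] M] : IsPadicProfinite p M where
  haus x hx := by
    have : IsHausdorff (IsLocalRing.maximalIdeal ℤ_[p]) M :=
      IsHausdorff.of_isLocalRing _ _ (Ideal.IsPrime.ne_top inferInstance)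
    exact IsHausdorff.haus this x fun m => by
      rw [SModEq.zero]
      exact PadicInt.mem_smul_top_iff.mpr (hx m)
  prec s hs := by
    obtain ⟨n, b, hb⟩ := Module.Finite.exists_fin (R := ℤ_[p]) (M := M)
    have hspan (x : M) : ∃ c : Fin n → ℤ_[p], ∑ j, c j • b j = x :=
      (Submodule.mem_span_range_iff_exists_fun _).mp (hb ▸ Submodule.mem_top)
    choose z hz using fun m => PadicInt.mem_primePowMultiples_iff.mp (hs m)
    choose c hc using fun m => hspan (z m)
    choose α hα using fun j => PadicInt.exists_sum_sub_eq_pow_mul fun i => c i j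
    choose β hβ using hα
    have hsum (m : ℕ) : s m = s 0 + ∑ j, (∑ i ∈ Finset.range m, (p : ℤ_[p]) ^ i * c i j) • b j := by
      induction m with
      | zero => simp
      | succ m ih =>
        simp only [Finset.sum_range_succ, add_smul, Finset.sum_add_distrib]
        rw [← add_assoc, ← ih, ← sub_eq_iff_eq_add', ← hz m, ← hc m, Finset.smul_sum]
        simp only [mul_smul]
    refine ⟨s 0 + ∑ j, α j • b j, fun m => PadicInt.mem_primePowMultiples_iff.mpr
      ⟨∑ j, β j m • b j, ?_⟩⟩
    rw [hsum m, add_sub_add_left_eq_sub, ← Finset.sum_sub_distrib, Finset.smul_sum]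
    refine Finset.sum_congr rfl fun j _ => ?_
    rw [← sub_smul, hβ, mul_smul]
  finite_quotient m := by
    let I : Ideal ℤ_[p] := IsLocalRing.maximalIdeal ℤ_[p] ^ m
    have hI : I = RingHom.ker (PadicInt.toZModPow (p := p) m) := by
      rw [PadicInt.ker_toZModPow, ← Ideal.span_singleton_pow, ← PadicInt.maximalIdeal_eq_span_p]
    have : NeZero (p ^ m) := ⟨pow_ne_zero m (Fact.out : p.Prime).ne_zero⟩
    have : Finite (ℤ_[p] ⧸ I) := by
      rw [hI]
      exact Finite.of_injective _ (RingHom.kerLift_injective (PadicInt.toZModPow (p := p) m))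
    have : Finite (M ⧸ (I • ⊤ : Submodule ℤ_[p] M)) :=
      Module.finite_of_finite (ℤ_[p] ⧸ I)
    have heq : (I • ⊤ : Submodule ℤ_[p] M).toAddSubgroup = primePowMultiples p M m :=
      AddSubgroup.ext fun x => PadicInt.mem_smul_top_iff
    rw [← heq]
    exact this

end PadicInt

section Fsu

variable {p : ℕ} [Fact p.Prime] {R M : Type*} [CommRing R] [Algebra ℤ_[p] R] [AddCommGroup M]
  [Module R M] [Module ℤ_[p] M] [IsScalarTower ℤ_[p] R M] [Module.Finite ℤ_[p] M]

theorem exists_mem_powLimFixed_apply_eq {f : Module.End R M} {x : M}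
    (hx : x ∈ powLimFixed p f) : ∃ y ∈ powLimFixed p f, f y = x := by
  have hM : IsPadicProfinite p M := PadicInt.isPadicProfinite
  let N : Submodule ℤ_[p] M := (powLimFixed p f).restrictScalars ℤ_[p]
  have hN : N ≤ N.map (f.restrictScalars ℤ_[p]) := by
    refine Submodule.le_of_le_smul_of_le_jacobson_bot (I := IsLocalRing.maximalIdeal ℤ_[p])
      (IsNoetherian.noetherian N) (IsLocalRing.jacobson_eq_maximalIdeal _ bot_ne_top).ge ?_
    intro x hx
    obtain ⟨y, hy, z, hz, rfl⟩ := exists_add_smul_of_mem_powLimFixed hM hx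
    refine Submodule.add_mem_sup (Submodule.mem_map_of_mem (f := f.restrictScalars ℤ_[p]) hy) ?_
    rw [← Nat.cast_smul_eq_nsmul ℤ_[p]]
    refine Submodule.smul_mem_smul ?_ hz
    rw [PadicInt.maximalIdeal_eq_span_p]
    exact Ideal.mem_span_singleton_self _
  exact hN hx

variable {H : Type*} [CommMonoid H] (ρ : H →* Module.End R M) {tp : H}

theorem commute_map_of_commMonoid (s t : H) : Commute (ρ s) (ρ t) :=
  (Commute.all s t).map ρ

theorem bijOn_powLimFixed (hdom : Dominating tp) (t : H) :
    Set.BijOn (ρ t) (powLimFixed p (ρ tp)) (powLimFixed p (ρ tp)) := by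
  have hM : IsPadicProfinite p M := PadicInt.isPadicProfinite
  have hmaps (u : H) {x : M} (hx : x ∈ powLimFixed p (ρ tp)) :
      ρ u x ∈ powLimFixed p (ρ tp) :=
    map_mem_powLimFixed (commute_map_of_commMonoid ρ u tp) hx
  obtain ⟨K, hK⟩ := hdom t
  refine ⟨fun x hx => hmaps t hx, fun x hx y hy hxy => ?_, fun x hx => ?_⟩
  · rw [← sub_eq_zero]
    refine PowLim.unique hM (PowLim.sub hx hy) fun m => ⟨K, fun k hk => ?_⟩
    obtain ⟨s, hs⟩ := hK (k.factorial) (hk.trans k.self_le_factorial)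
    rw [← map_pow, hs, mul_comm, map_mul, Module.End.mul_apply, map_sub, hxy]
    simp [zero_mem]
  · have hpow (n : ℕ) : ∃ y ∈ powLimFixed p (ρ tp), (ρ tp ^ n) y = x := by
      induction n with
      | zero => exact ⟨x, hx, by simp⟩
      | succ n ih =>
        obtain ⟨y, hy, hyx⟩ := ih
        obtain ⟨z, hz, rfl⟩ := exists_mem_powLimFixed_apply_eq hy
        exact ⟨z, hz, by rw [pow_succ, Module.End.mul_apply, hyx]⟩
    obtain ⟨y, hy, hyx⟩ := hpow K
    obtain ⟨s, hs⟩ := hK K le_rfl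
    refine ⟨ρ s y, hmaps s hy, ?_⟩
    rw [← hyx, ← map_pow, hs, map_mul, Module.End.mul_apply]

theorem fsuPart_eq_powLimFixed [IsNoetherianRing R] [Module.Finite R M] (hdom : Dominating tp) :
    fsuPart R M ρ = powLimFixed p (ρ tp) := by
  refine le_antisymm (sSup_le fun N hN x hx => ?_) (le_sSup ⟨IsNoetherian.noetherian _,
    fun t => (bijOn_powLimFixed ρ hdom t).mapsTo, fun t => (bijOn_powLimFixed ρ hdom t).surjOn⟩)
  exact PowLim.self_of_surjOn PadicInt.isPadicProfinite (hN.2.2 tp) hx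

end Fsu

/-- Let `O` be the ring of integers of a finite extension `E` of `ℚ_p`, and assume the commutative
monoid `H⁺` has a dominating element `tp`.  Let `J` be an `O[H⁺]`-module which is finitely
generated as an `O`-module.  Then there is a decomposition `J = J_fsu ⊕ J'` into `H⁺`-stable
`O`-submodules such that every `t ∈ H⁺` acts bijectively on `J_fsu` and `tp` acts topologically
nilpotently on `J'`: for every `x ∈ J'` and every `m ≥ 0` there is `k ≥ 0` with
`tpᵏ·x ∈ pᵐJ'`. -/
theorem fsu_topNilpotent_decomposition
    (p : ℕ) [Fact p.Prime] (E : Type*) [Field E]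
    [Algebra ℚ_[p] E] [FiniteDimensional ℚ_[p] E]
    [Algebra ℤ_[p] E] [IsScalarTower ℤ_[p] ℚ_[p] E]
    {H : Type*} [CommMonoid H]
    (J : Type*) [AddCommGroup J] [Module (PadicROI p E) J] [Module.Finite (PadicROI p E) J]
    (ρ : H →* Module.End (PadicROI p E) J)
    (tp : H) (hdom : Dominating tp) :
    ∃ J' : Submodule (PadicROI p E) J,
      (∀ t : H, ∀ x ∈ fsuPart (PadicROI p E) J ⇑ρ, ρ t x ∈ fsuPart (PadicROI p E) J ⇑ρ) ∧
      (∀ t : H, ∀ x ∈ J', ρ t x ∈ J') ∧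
      IsCompl (fsuPart (PadicROI p E) J ⇑ρ) J' ∧
      (∀ t : H, Set.BijOn ⇑(ρ t) ↑(fsuPart (PadicROI p E) J ⇑ρ)
        ↑(fsuPart (PadicROI p E) J ⇑ρ)) ∧
      (∀ x ∈ J', ∀ m : ℕ, ∃ k : ℕ, ∃ z ∈ J',
        ρ (tp ^ k) x = ((p : PadicROI p E)) ^ m • z) := by
  have hfin : Module.Finite ℤ_[p] (PadicROI p E) :=
    have := charZero_of_injective_algebraMap (algebraMap ℚ_[p] E).injective
    have := IsIntegralClosure.isNoetherian ℤ_[p] ℚ_[p] E (PadicROI p E)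
    Module.IsNoetherian.finite _ _
  have : IsNoetherianRing (PadicROI p E) := IsNoetherianRing.of_finite ℤ_[p] _
  let _ : Module ℤ_[p] J := Module.compHom J (algebraMap ℤ_[p] (PadicROI p E))
  have : IsScalarTower ℤ_[p] (PadicROI p E) J := .of_algebraMap_smul fun _ _ => rfl
  have : Module.Finite ℤ_[p] J := .trans (PadicROI p E) J
  have hJ : IsPadicProfinite p J := PadicInt.isPadicProfinite
  have hcomm (t : H) : Commute (ρ t) (ρ tp) := commute_map_of_commMonoid ρ t tp
  rw [fsuPart_eq_powLimFixed (p := p) ρ hdom]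
  refine ⟨powLimKer p (ρ tp), fun t x => map_mem_powLimFixed (hcomm t),
    fun t x => map_mem_powLimKer (hcomm t), isCompl_powLimFixed_powLimKer hJ _,
    bijOn_powLimFixed ρ hdom, fun x hx m => ?_⟩
  obtain ⟨k, z, hz, hk⟩ := exists_mem_powLimKer_pow_apply_eq hJ hx m
  refine ⟨k, z, hz, ?_⟩
  rw [map_pow, hk, ← Nat.cast_pow, Nat.cast_smul_eq_nsmul]
end

section
/- Assume H⁺ has a dominating element. Let J be an O[H⁺]-module which is finitely generated as an O-module. Then there is a unique decomposition ((J ⊗_O E))_fsu = W_ord ⊕ W_sup into H⁺-stable E-subspaces such that every character χ : H⁺ → ℚ̄_p^× occurring in W_ord ⊗_E ℚ̄_p is ordinary and every character occurring in W_sup ⊗_E ℚ̄_p is supersingular. Moreover, W_ord = J_fsu ⊗_O E. -/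
set_option synthInstance.maxHeartbeats 1000000
set_option maxHeartbeats 1000000

open scoped TensorProduct

section

variable (O : Type*) [CommRing O] {H : Type*} [CommMonoid H]
variable (E C : Type*) [Field E] [Field C] [Algebra O E] [Algebra O C]
variable (J : Type*) [AddCommGroup J] [Module O J]

/-- A monoid homomorphism `χ : H⁺ → C^×` occurs in `W' ⊗_E C`, for an `E`-subspace `W'` of
`W = E ⊗_O J`: there is a nonzero vector `x` of `C ⊗_O J` lying in the `C`-span of the image of
`W'` which is a simultaneous eigenvector for the (base-changed) `H⁺`-action with eigenvalue
system `χ`. -/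
def OccursIn (ι : E →ₐ[O] C) (ρ : H →* Module.End O J) (χ : H →* Cˣ)
    (W' : Submodule E (E ⊗[O] J)) : Prop :=
  ∃ x ∈ Submodule.span C
      (⇑(LinearMap.rTensor J ι.toLinearMap) ''
        (W' : Set (E ⊗[O] J))),
    x ≠ 0 ∧ ∀ t : H, LinearMap.baseChange C (ρ t) x = (χ t : C) • x

/-- The pair `(W_ord, W_sup)` of `E`-subspaces of `W = E ⊗_O J` gives the desired decomposition
`(J ⊗_O E)_fsu = W_ord ⊕ W_sup`: both subspaces are `H⁺`-stable, they intersect trivially, their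
sum is the finitely surjective part of `J ⊗_O E`, every character occurring in `W_ord ⊗_E C` is
ordinary (all its values have absolute value `1`), and every character occurring in
`W_sup ⊗_E C` is supersingular (all its values have absolute value `≤ 1`, but not all `= 1`). -/
def GoodPair (ι : E →ₐ[O] C) (v : AbsoluteValue C ℝ) (ρ : H →* Module.End O J)
    (P : Submodule E (E ⊗[O] J) × Submodule E (E ⊗[O] J)) : Prop :=
  (∀ t : H, ∀ x ∈ P.1, LinearMap.baseChange E (ρ t) x ∈ P.1) ∧
  (∀ t : H, ∀ x ∈ P.2, LinearMap.baseChange E (ρ t) x ∈ P.2) ∧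
  P.1 ⊓ P.2 = ⊥ ∧
  P.1 ⊔ P.2 = fsuPart E (E ⊗[O] J) (fun t => LinearMap.baseChange E (ρ t)) ∧
  (∀ χ : H →* Cˣ, OccursIn O E C J ι ρ χ P.1 → ∀ t : H, v ((χ t : C)) = 1) ∧
  (∀ χ : H →* Cˣ, OccursIn O E C J ι ρ χ P.2 →
    (∀ t : H, v ((χ t : C)) ≤ 1) ∧ ¬ (∀ t : H, v ((χ t : C)) = 1))

end

section Valuation

open Polynomial

variable {p : ℕ} [Fact p.Prime] {C : Type*} [Field C] [Algebra ℚ_[p] C]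
  [Algebra.IsAlgebraic ℚ_[p] C]

theorem absoluteValue_le_one_iff_isIntegral [Algebra ℤ_[p] C] [IsScalarTower ℤ_[p] ℚ_[p] C]
    (v : AbsoluteValue C ℝ)
    (hv : ∀ x : ℚ_[p], v (algebraMap ℚ_[p] C x) = ‖x‖) (x : C) :
    v x ≤ 1 ↔ IsIntegral ℤ_[p] x := by
  have hx : IsIntegral ℚ_[p] x := Algebra.IsIntegral.isIntegral x
  rw [spectralNorm_unique_field_norm_ext hv, spectralNorm,
    spectralValue_le_one_iff (minpoly.monic hx)]
  constructor
  · intro h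
    have hl : minpoly ℚ_[p] x ∈ Polynomial.lifts (algebraMap ℤ_[p] ℚ_[p]) :=
      (Polynomial.lifts_iff_coeff_lifts _).2 fun n => ⟨⟨_, h n⟩, rfl⟩
    obtain ⟨q, hq, -, hm⟩ := Polynomial.lifts_and_natDegree_eq_and_monic hl (minpoly.monic hx)
    refine ⟨q, hm, ?_⟩
    rw [← aeval_def, ← aeval_map_algebraMap ℚ_[p], hq, minpoly.aeval]
  · intro h n
    rw [minpoly.isIntegrallyClosed_eq_field_fractions' ℚ_[p] h, coeff_map]
    exact PadicInt.norm_le_one _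

theorem absoluteValue_eq_of_minpoly_eq (v : AbsoluteValue C ℝ)
    (hv : ∀ x : ℚ_[p], v (algebraMap ℚ_[p] C x) = ‖x‖)
    {E : Type*} [Field E] [Algebra ℚ_[p] E] [Algebra E C] [IsScalarTower ℚ_[p] E C]
    (x y : C) (h : minpoly E x = minpoly E y) : v x = v y := by
  have key : minpoly ℚ_[p] x = minpoly ℚ_[p] y := by
    refine minpoly.eq_of_irreducible_of_monic
      (minpoly.irreducible (Algebra.IsIntegral.isIntegral x)) ?_
      (minpoly.monic (Algebra.IsIntegral.isIntegral x))
    obtain ⟨r, hr⟩ := minpoly.dvd_map_of_isScalarTower ℚ_[p] E x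
    rw [← aeval_map_algebraMap E, hr, h, map_mul, minpoly.aeval, zero_mul]
  rw [spectralNorm_unique_field_norm_ext hv, spectralNorm_unique_field_norm_ext hv, spectralNorm,
    spectralNorm, key]

end Valuation

section Factorization

open Polynomial

variable {E C : Type*} [Field E] [Field C] [Algebra E C]

theorem exists_mul_eq_of_roots_le_one (v : AbsoluteValue C ℝ)
    (hconj : ∀ x y : C, minpoly E x = minpoly E y → v x = v y) (g : E[X]) (hg : g ≠ 0)
    (hroots : ∀ c : C, aeval c g = 0 → v c ≤ 1) :
    ∃ a b : E[X], a * b = g ∧ (∀ c : C, aeval c a = 0 → v c = 1) ∧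
      (∀ c : C, aeval c b = 0 → v c < 1) := by
  induction g using UniqueFactorizationMonoid.induction_on_prime with
  | h₁ => exact absurd rfl hg
  | h₂ u hu =>
    refine ⟨1, u, one_mul u, fun c hc => by simp at hc, fun c hc => ?_⟩
    exact absurd hc (hu.map (aeval c)).ne_zero
  | h₃ g q hg0 hq ih =>
    obtain ⟨a, b, hab, ha, hb⟩ := ih hg0 fun c hc => hroots c (by rw [map_mul, hc, mul_zero])
    have hmin (c d : C) (hc : aeval c q = 0) (hd : aeval d q = 0) : v c = v d :=
      hconj _ _ <| by
        rw [← minpoly.eq_of_irreducible hq.irreducible hc,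
          ← minpoly.eq_of_irreducible hq.irreducible hd]
    by_cases h : ∃ c : C, aeval c q = 0 ∧ v c = 1
    · obtain ⟨c, hc, hc1⟩ := h
      refine ⟨q * a, b, by rw [mul_assoc, hab], fun d hd => ?_, hb⟩
      rcases mul_eq_zero.1 ((map_mul (aeval d) q a).symm.trans hd) with h | h
      · rw [hmin d c h hc, hc1]
      · exact ha d h
    · push Not at h
      refine ⟨a, q * b, by rw [mul_left_comm, hab], ha, fun d hd => ?_⟩
      rcases mul_eq_zero.1 ((map_mul (aeval d) q b).symm.trans hd) with h' | h'
      · exact lt_of_le_of_ne (hroots d (by rw [map_mul, h', zero_mul])) (h d h')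
      · exact hb d h'

/-- If all roots of a monic polynomial have absolute value `1`, so does its constant term. -/
theorem absoluteValue_coeff_zero_eq_one [IsAlgClosed C] (v : AbsoluteValue C ℝ) (a : E[X])
    (ha : a.Monic) (h : ∀ c : C, aeval c a = 0 → v c = 1) :
    v (algebraMap E C (a.coeff 0)) = 1 := by
  rw [← coeff_map, (IsAlgClosed.splits _).coeff_zero_eq_prod_roots_of_monic (ha.map _), map_mul,
    map_pow, v.map_neg, map_one, one_pow, one_mul, map_multiset_prod]
  refine Multiset.prod_eq_one fun r hr => ?_
  obtain ⟨c, hc, rfl⟩ := Multiset.mem_map.1 hr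
  refine h c ?_
  have := (mem_roots'.1 hc).2
  rwa [IsRoot.def, eval_map_algebraMap] at this

/-- A monic integral polynomial splits over the fraction field into a factor with unit constant
term whose roots are units, and a coprime factor whose roots are topologically nilpotent. -/
theorem exists_unit_mul_nilpotent_factorization {O : Type*} [CommRing O] [IsDomain O]
    [IsIntegrallyClosed O]
    [Algebra O E] [IsFractionRing O E] [Algebra O C] [IsScalarTower O E C] [IsAlgClosed C]
    (v : AbsoluteValue C ℝ)
    (hint : ∀ x : C, IsIntegral O x → v x ≤ 1)
    (hO : ∀ x : E, v (algebraMap E C x) ≤ 1 → ∃ y : O, algebraMap O E y = x)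
    (hconj : ∀ x y : C, minpoly E x = minpoly E y → v x = v y)
    (q : O[X]) (hq : q.Monic) :
    ∃ (a : O[X]) (b : E[X]), a.map (algebraMap O E) * b = q.map (algebraMap O E) ∧
      IsUnit (a.coeff 0) ∧ (∀ c : C, aeval c a = 0 → v c = 1) ∧
      (∀ c : C, aeval c b = 0 → v c < 1) := by
  have hq0 : q.map (algebraMap O E) ≠ 0 := (hq.map _).ne_zero
  obtain ⟨a, b, hab, ha, hb⟩ := exists_mul_eq_of_roots_le_one v hconj _ hq0 fun c hc =>
    hint c ⟨q, hq, by rwa [aeval_map_algebraMap] at hc⟩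
  have ha0 : a ≠ 0 := fun h => hq0 (by rw [← hab, h, zero_mul])
  have hl : a.leadingCoeff ≠ 0 := leadingCoeff_ne_zero.2 ha0
  obtain ⟨F, hF⟩ := IsIntegrallyClosed.eq_map_mul_C_of_dvd E hq (Dvd.intro b hab)
  have hFa : F.map (algebraMap O E) = a * Polynomial.C a.leadingCoeff⁻¹ := by
    nth_rw 1 [← hF]
    rw [mul_assoc, ← C_mul, mul_inv_cancel₀ hl, C_1, mul_one]
  have hFm : (F.map (algebraMap O E)).Monic := hFa ▸ monic_mul_leadingCoeff_inv ha0
  have hFr (c : C) (hc : aeval c (F.map (algebraMap O E)) = 0) : v c = 1 := ha c <| by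
    rw [← hF, map_mul, hc, zero_mul]
  refine ⟨F, Polynomial.C a.leadingCoeff * b, by rw [← mul_assoc, hF, hab], ?_, fun c hc => ?_,
    fun c hc => ?_⟩
  · have h1 := absoluteValue_coeff_zero_eq_one v _ hFm hFr
    obtain ⟨y, hy⟩ := hO ((F.map (algebraMap O E)).coeff 0)⁻¹
      (by rw [map_inv₀, map_inv₀, h1, inv_one])
    refine IsUnit.of_mul_eq_one y (IsFractionRing.injective O E ?_)
    rw [map_mul, hy, map_one, ← coeff_map, mul_inv_cancel₀]
    intro h0
    rw [h0] at h1
    simp at h1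
  · exact hFr c (by rwa [aeval_map_algebraMap])
  · refine hb c ?_
    rw [map_mul, aeval_C] at hc
    exact (mul_eq_zero.1 hc).resolve_left ((_root_.map_ne_zero _).2 hl)

end Factorization

section FinitelySurjective

variable {R : Type*} [CommRing R] {H : Type*} [CommMonoid H]
  {M : Type*} [AddCommGroup M] [Module R M]

theorem apply_mem_fsuPart (ρ : H → Module.End R M) (t : H) {x : M} (hx : x ∈ fsuPart R M ρ) :
    ρ t x ∈ fsuPart R M ρ := by
  have h : fsuPart R M ρ ≤ (fsuPart R M ρ).comap (ρ t) :=
    sSup_le fun N hN x hx => le_sSup (a := N) hN (hN.2.1 t x hx)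
  exact h hx

theorem exists_mem_fsuPart_apply_eq (ρ : H → Module.End R M) (t : H) {x : M}
    (hx : x ∈ fsuPart R M ρ) : ∃ y ∈ fsuPart R M ρ, ρ t y = x := by
  have h : fsuPart R M ρ ≤ (fsuPart R M ρ).map (ρ t) := sSup_le fun N hN x hx => by
    obtain ⟨y, hy, rfl⟩ := hN.2.2 t x hx
    exact ⟨y, le_sSup (a := N) hN hy, rfl⟩
  exact h hx

theorem le_fsuPart {ρ : H → Module.End R M} {N : Submodule R M} (h : IsFinSurjSub R ρ N) :
    N ≤ fsuPart R M ρ :=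
  le_sSup h

/-- Surjectivity of a dominating element on a stable submodule implies surjectivity of all
elements. -/
theorem Dominating.exists_apply_eq {tp : H} (htp : Dominating tp) (ρ : H →* Module.End R M)
    {N : Submodule R M} (hst : ∀ t, ∀ x ∈ N, ρ t x ∈ N) (hs : ∀ x ∈ N, ∃ y ∈ N, ρ tp y = x)
    (t : H) (x : M) (hx : x ∈ N) : ∃ y ∈ N, ρ t y = x := by
  have hpow (k : ℕ) : ∀ x ∈ N, ∃ y ∈ N, ρ (tp ^ k) y = x := by
    induction k with
    | zero => exact fun x hx => ⟨x, hx, by simp⟩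
    | succ k ih =>
      intro x hx
      obtain ⟨y, hy, rfl⟩ := ih x hx
      obtain ⟨z, hz, rfl⟩ := hs y hy
      exact ⟨z, hz, by rw [pow_succ, map_mul, Module.End.mul_apply]⟩
  obtain ⟨K, hK⟩ := htp t
  obtain ⟨s, hs⟩ := hK K le_rfl
  obtain ⟨y, hy, rfl⟩ := hpow K x hx
  exact ⟨ρ s y, hst s y hy, by rw [hs, map_mul, Module.End.mul_apply]⟩

theorem aeval_apply_mem {f : Module.End R M} {N : Submodule R M} (h : ∀ x ∈ N, f x ∈ N)
    (g : Polynomial R) {x : M} (hx : x ∈ N) : Polynomial.aeval f g x ∈ N := by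
  induction g using Polynomial.induction_on' generalizing x with
  | add a b ha hb => rw [map_add]; exact N.add_mem (ha hx) (hb hx)
  | monomial n r =>
    rw [Polynomial.aeval_monomial, Module.End.mul_apply, Module.algebraMap_end_apply]
    refine N.smul_mem _ ?_
    induction n with
    | zero => simpa using hx
    | succ n ih => rw [pow_succ', Module.End.mul_apply]; exact h _ ih

theorem coe_aeval_restrict {f : Module.End R M} {N : Submodule R M} (h : ∀ x ∈ N, f x ∈ N)
    (g : Polynomial R) (x : N) :
    (Polynomial.aeval (f.restrict h : Module.End R N) g x : M) = Polynomial.aeval f g (x : M) := by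
  induction g using Polynomial.induction_on' generalizing x with
  | add a b ha hb => simp only [map_add, LinearMap.add_apply, Submodule.coe_add, ha, hb]
  | monomial n r =>
    simp only [Polynomial.aeval_monomial, Module.End.mul_apply, Module.algebraMap_end_apply,
      Submodule.coe_smul, Module.End.pow_restrict n h, LinearMap.restrict_apply]

end FinitelySurjective

section Reflect

open Polynomial

theorem aeval_reflect_of_mul_eq_one {R A : Type*} [CommRing R] [Ring A] [Algebra R A] {f g : A}
    (hfg : f * g = 1) (h : R[X]) (N : ℕ) (hN : h.natDegree ≤ N) :
    aeval f (reflect N h) = f ^ N * aeval g h := by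
  refine Polynomial.induction_with_natDegree_le
    (fun h : R[X] => aeval f (reflect N h) = f ^ N * aeval g h) N ?_ ?_ ?_ h hN
  · simp
  · intro n r hr hn
    have hpow : ∀ n : ℕ, f ^ n * g ^ n = 1 := fun n => by
      induction n with
      | zero => simp
      | succ n ih => rw [pow_succ, pow_succ', mul_assoc, ← mul_assoc f g, hfg, one_mul, ih]
    rw [reflect_C_mul_X_pow, revAt_le hn, map_mul, map_mul, aeval_C, aeval_C, map_pow, map_pow,
      aeval_X, aeval_X, ← mul_assoc, ← Algebra.commutes, mul_assoc]
    congr 1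
    obtain ⟨k, rfl⟩ := Nat.exists_eq_add_of_le' hn
    rw [Nat.add_sub_cancel, pow_add, mul_assoc, hpow, mul_one]
  · intro a b hab hb ha hb'
    rw [reflect_add, map_add, map_add, mul_add, ha, hb']

/-- A surjective endomorphism of a Noetherian module is killed by the reverse of a monic
polynomial. -/
theorem exists_monic_aeval_reverse_eq_zero {R M : Type*} [CommRing R] [AddCommGroup M]
    [Module R M] [IsNoetherian R M] (f : Module.End R M) (hf : Function.Surjective f) :
    ∃ h : R[X], h.Monic ∧ aeval f h.reverse = 0 := by
  let e := LinearEquiv.ofBijective f (IsNoetherian.bijective_of_surjective_endomorphism f hf)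
  obtain ⟨h, hm, h0⟩ := LinearMap.exists_monic_and_aeval_eq_zero R (e.symm : Module.End R M)
  refine ⟨h, hm, ?_⟩
  rw [reverse, aeval_reflect_of_mul_eq_one (g := (e.symm : Module.End R M)) _ h _ le_rfl, h0,
    mul_zero]
  ext x
  exact e.apply_symm_apply x

end Reflect

theorem exists_common_eigenvector {K M H : Type*} [Field K] [IsAlgClosed K] [AddCommGroup M]
    [Module K M] [FiniteDimensional K M] (f : H → Module.End K M)
    (hcomm : ∀ s t, Commute (f s) (f t)) (U : Submodule K M) (hU : U ≠ ⊥)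
    (hst : ∀ t, ∀ x ∈ U, f t x ∈ U) :
    ∃ x ∈ U, x ≠ 0 ∧ ∀ t, ∃ c : K, f t x = c • x := by
  obtain ⟨N, ⟨hN0, hNU, hN⟩, hmin⟩ := wellFounded_lt.has_min
    {N : Submodule K M | N ≠ ⊥ ∧ N ≤ U ∧ ∀ t, ∀ x ∈ N, f t x ∈ N} ⟨U, hU, le_rfl, hst⟩
  obtain ⟨x, hx, hx0⟩ := N.ne_bot_iff.1 hN0
  refine ⟨x, hNU hx, hx0, fun t => ?_⟩
  have : Nontrivial N := Submodule.nontrivial_iff_ne_bot.2 hN0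
  obtain ⟨c, hc⟩ := Module.End.exists_eigenvalue ((f t).restrict (hN t))
  obtain ⟨y, hy⟩ := hc.exists_hasEigenvector
  have hy' : f t y = c • (y : M) := congrArg Subtype.val hy.apply_eq_smul
  refine ⟨c, ?_⟩
  let N' : Submodule K M := N ⊓ LinearMap.ker (f t - algebraMap K _ c)
  have hmem (z : M) : z ∈ N' ↔ z ∈ N ∧ f t z = c • z := by
    simp [N', sub_eq_zero, Module.algebraMap_end_apply]
  have hN' : ¬ N' < N := hmin N' ⟨?_, inf_le_left.trans hNU, fun s z hz => ?_⟩
  · have : N' = N := eq_of_le_of_not_lt inf_le_left hN'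
    exact ((hmem x).1 (this ▸ hx)).2
  · exact N'.ne_bot_iff.2 ⟨y, (hmem _).2 ⟨y.2, hy'⟩, fun h => hy.2 (Subtype.ext h)⟩
  · rw [hmem] at hz ⊢
    refine ⟨hN s z hz.1, ?_⟩
    rw [← Module.End.mul_apply, (hcomm t s).eq, Module.End.mul_apply, hz.2, map_smul]

section BaseChange

open Polynomial

variable {O : Type*} [CommRing O] {E C : Type*} [Field E] [Field C] [Algebra O E] [Algebra O C]
  [Algebra E C] [IsScalarTower O E C] {J : Type*} [AddCommGroup J] [Module O J]

theorem aeval_baseChange {A : Type*} [CommRing A] [Algebra O A] (f : Module.End O J) (g : O[X]) :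
    aeval (LinearMap.baseChange A f : Module.End A (A ⊗[O] J)) (g.map (algebraMap O A)) =
      LinearMap.baseChange A (aeval f g) := by
  rw [aeval_map_algebraMap]
  exact aeval_algHom_apply (Module.End.baseChangeHom O A J) f g

theorem commute_baseChange {A : Type*} [CommRing A] [Algebra O A] {H : Type*} [CommMonoid H]
    (ρ : H →* Module.End O J) (s t : H) :
    Commute (LinearMap.baseChange A (ρ s) : Module.End A (A ⊗[O] J))
      (LinearMap.baseChange A (ρ t)) :=
  ((Commute.all s t).map ρ).map (Module.End.baseChangeHom O A J)

theorem commute_aeval_baseChange {A : Type*} [CommRing A] [Algebra O A] {H : Type*} [CommMonoid H]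
    (ρ : H →* Module.End O J) (s t : H) (g : A[X]) :
    Commute (aeval (LinearMap.baseChange A (ρ s) : Module.End A (A ⊗[O] J)) g)
      (LinearMap.baseChange A (ρ t)) := by
  induction g using Polynomial.induction_on' with
  | add a b ha hb => rw [map_add]; exact ha.add_left hb
  | monomial n r =>
    rw [aeval_monomial]
    exact Commute.mul_left (Algebra.commutes r _) ((commute_baseChange ρ s t).pow_left n)

local notation "Φ" => LinearMap.rTensor J (AlgHom.toLinearMap (IsScalarTower.toAlgHom O E C))

theorem rTensor_smul (e : E) (w : E ⊗[O] J) : Φ (e • w) = algebraMap E C e • Φ w := by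
  induction w with
  | zero => simp
  | add x y hx hy => rw [smul_add, map_add, map_add, smul_add, hx, hy]
  | tmul a y => simp [TensorProduct.smul_tmul', Algebra.smul_def]

theorem rTensor_baseChange (f : Module.End O J) (w : E ⊗[O] J) :
    Φ (LinearMap.baseChange E f w) = LinearMap.baseChange C f (Φ w) := by
  induction w with
  | zero => simp
  | add x y hx hy => simp only [map_add, hx, hy]
  | tmul a y => simp

theorem rTensor_aeval (f : Module.End O J) (g : E[X]) (w : E ⊗[O] J) :
    Φ (aeval (LinearMap.baseChange E f : Module.End E (E ⊗[O] J)) g w) =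
      aeval (LinearMap.baseChange C f : Module.End C (C ⊗[O] J)) (g.map (algebraMap E C))
        (Φ w) := by
  induction g using Polynomial.induction_on' generalizing w with
  | add a b ha hb => simp only [map_add, Polynomial.map_add, LinearMap.add_apply, ha, hb]
  | monomial n r =>
    rw [map_monomial, aeval_monomial, aeval_monomial, Module.End.mul_apply, Module.End.mul_apply,
      Module.algebraMap_end_apply, Module.algebraMap_end_apply, rTensor_smul]
    congr 1
    induction n generalizing w with
    | zero => simp
    | succ n ih => rw [pow_succ, pow_succ, Module.End.mul_apply, Module.End.mul_apply, ih,
        rTensor_baseChange]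

theorem rTensor_injective : Function.Injective Φ := by
  obtain ⟨r, hr⟩ := (Algebra.linearMap E C).exists_leftInverse_of_injective
    (LinearMap.ker_eq_bot.2 (algebraMap E C).injective)
  refine Function.HasLeftInverse.injective ⟨LinearMap.rTensor J (r.restrictScalars O), fun w => ?_⟩
  rw [← LinearMap.comp_apply, ← LinearMap.rTensor_comp]
  have : (r.restrictScalars O) ∘ₗ (IsScalarTower.toAlgHom O E C).toLinearMap = LinearMap.id :=
    LinearMap.ext fun x => LinearMap.congr_fun hr x
  rw [this, LinearMap.rTensor_id, LinearMap.id_apply]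

variable {H : Type*} [CommMonoid H] {ρ : H →* Module.End O J}

/-- An eigenvalue occurring in a subspace is a root of every polynomial killing that subspace. -/
theorem OccursIn.aeval_eq_zero {χ : H →* Cˣ} {U : Submodule E (E ⊗[O] J)}
    (h : OccursIn O E C J (IsScalarTower.toAlgHom O E C) ρ χ U) (t : H) (g : E[X])
    (hg : ∀ x ∈ U, aeval (LinearMap.baseChange E (ρ t) : Module.End E (E ⊗[O] J)) g x = 0) :
    aeval (χ t : C) g = 0 := by
  obtain ⟨x, hx, hx0, he⟩ := h
  have hle : Submodule.span C (Φ '' (U : Set (E ⊗[O] J))) ≤ LinearMap.ker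
      (aeval (LinearMap.baseChange C (ρ t) : Module.End C (C ⊗[O] J))
        (g.map (algebraMap E C))) := by
    rw [Submodule.span_le]
    rintro _ ⟨w, hw, rfl⟩
    rw [SetLike.mem_coe, LinearMap.mem_ker, ← rTensor_aeval, hg w hw, map_zero]
  have h0 := hle hx
  rw [LinearMap.mem_ker, Module.End.aeval_apply_of_hasEigenvector
    (Module.End.hasEigenvector_iff.2 ⟨Module.End.mem_eigenspace_iff.2 (he t), hx0⟩),
    eval_map_algebraMap] at h0
  exact (smul_eq_zero.1 h0).resolve_right hx0

theorem OccursIn.isIntegral [Module.Finite O J] {χ : H →* Cˣ} {U : Submodule E (E ⊗[O] J)}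
    (h : OccursIn O E C J (IsScalarTower.toAlgHom O E C) ρ χ U) (t : H) :
    IsIntegral O (χ t : C) := by
  obtain ⟨q, hq, h0⟩ := LinearMap.exists_monic_and_aeval_eq_zero O (ρ t)
  refine ⟨q, hq, ?_⟩
  rw [← aeval_def, ← aeval_map_algebraMap E]
  refine h.aeval_eq_zero t _ fun x _ => ?_
  rw [aeval_baseChange, h0, LinearMap.baseChange_zero, LinearMap.zero_apply]

theorem exists_occursIn [IsAlgClosed C] [Module.Finite O J] (U : Submodule E (E ⊗[O] J))
    (hU : U ≠ ⊥) (hst : ∀ t : H, ∀ x ∈ U, LinearMap.baseChange E (ρ t) x ∈ U)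
    (hinj : ∀ t : H, ∀ x ∈ U, LinearMap.baseChange E (ρ t) x = 0 → x = 0) :
    ∃ χ : H →* Cˣ, OccursIn O E C J (IsScalarTower.toAlgHom O E C) ρ χ U := by
  let UC : Submodule C (C ⊗[O] J) := Submodule.span C (Φ '' (U : Set (E ⊗[O] J)))
  have hUC (t : H) : ∀ x ∈ UC, LinearMap.baseChange C (ρ t) x ∈ UC := by
    suffices h : UC ≤ UC.comap (LinearMap.baseChange C (ρ t)) from h
    refine Submodule.span_le.2 ?_
    rintro _ ⟨w, hw, rfl⟩
    rw [SetLike.mem_coe, Submodule.mem_comap, ← rTensor_baseChange]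
    exact Submodule.subset_span ⟨_, hst t w hw, rfl⟩
  have hsurj (t : H) : UC ≤ UC.map (LinearMap.baseChange C (ρ t)) := by
    refine Submodule.span_le.2 ?_
    rintro _ ⟨w, hw, rfl⟩
    have hi : Function.Injective ((LinearMap.baseChange E (ρ t)).restrict (hst t)) :=
      (injective_iff_map_eq_zero _).2 fun x hx =>
        Subtype.ext (hinj t x x.2 (congrArg Subtype.val hx))
    have hs := LinearMap.surjective_of_injective (K := E) (V := U)
      (f := (LinearMap.baseChange E (ρ t)).restrict (hst t)) hi
    obtain ⟨z, hz⟩ := hs ⟨w, hw⟩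
    refine ⟨Φ z, Submodule.subset_span ⟨z, z.2, rfl⟩, ?_⟩
    rw [← rTensor_baseChange]
    exact congrArg (fun y : U => Φ (y : E ⊗[O] J)) hz
  have hinjC (t : H) (x : C ⊗[O] J) (hx : x ∈ UC) (h0 : LinearMap.baseChange C (ρ t) x = 0) :
      x = 0 := by
    have hs : Function.Surjective ((LinearMap.baseChange C (ρ t)).restrict (hUC t)) := by
      rintro ⟨y, hy⟩
      obtain ⟨z, hz, rfl⟩ := hsurj t hy
      exact ⟨⟨z, hz⟩, rfl⟩
    have := (injective_iff_map_eq_zero _).1 (LinearMap.injective_iff_surjective.2 hs) ⟨x, hx⟩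
      (Subtype.ext h0)
    exact congrArg Subtype.val this
  have hne : UC ≠ ⊥ := by
    obtain ⟨w, hw, hw0⟩ := U.ne_bot_iff.1 hU
    exact UC.ne_bot_iff.2 ⟨Φ w, Submodule.subset_span ⟨w, hw, rfl⟩, fun h =>
      hw0 (rTensor_injective (h.trans (map_zero _).symm))⟩
  obtain ⟨x, hx, hx0, he⟩ := exists_common_eigenvector
    (fun t => (LinearMap.baseChange C (ρ t) : Module.End C (C ⊗[O] J)))
    (commute_baseChange ρ) UC hne hUC
  choose c hc using he
  have hc0 (t : H) : c t ≠ 0 := fun h => hx0 (hinjC t x hx (by rw [hc t, h, zero_smul]))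
  have hinjc {a b : C} (h : a • x = b • x) : a = b := smul_left_injective C hx0 h
  refine ⟨{ toFun := fun t => Units.mk0 (c t) (hc0 t)
            map_one' := Units.ext (hinjc ?_)
            map_mul' := fun s t => Units.ext (hinjc ?_) }, x, hx, hx0, hc⟩
  · change c 1 • x = (1 : C) • x
    rw [← hc, map_one, one_smul, Module.End.one_eq_id, LinearMap.baseChange_id,
      LinearMap.id_apply]
  · change c (s * t) • x = (c s * c t) • x
    rw [← hc, map_mul, Module.End.mul_eq_comp, LinearMap.baseChange_comp, LinearMap.comp_apply,
      hc t, map_smul, hc s, smul_smul, mul_comm]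

end BaseChange

section Decomposition

open Polynomial

variable {O : Type*} [CommRing O] {E C : Type*} [Field E] [Field C] [Algebra O E] [Algebra O C]
  [Algebra E C] [IsScalarTower O E C] {J : Type*} [AddCommGroup J] [Module O J]
  {H : Type*} [CommMonoid H] {ρ : H →* Module.End O J}

theorem span_fsuPart_le_fsuPart_baseChange [Module.Finite O J] :
    Submodule.span E ((fun y : J => (1 : E) ⊗ₜ[O] y) '' (fsuPart O J ⇑ρ : Set J)) ≤
      fsuPart E (E ⊗[O] J) fun t => LinearMap.baseChange E (ρ t) := by
  refine le_fsuPart ⟨IsNoetherian.noetherian _, fun t => ?_, fun t => ?_⟩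
  · suffices h : Submodule.span E ((fun y : J => (1 : E) ⊗ₜ[O] y) '' (fsuPart O J ⇑ρ : Set J)) ≤
        (Submodule.span E ((fun y : J => (1 : E) ⊗ₜ[O] y) '' (fsuPart O J ⇑ρ : Set J))).comap
          (LinearMap.baseChange E (ρ t)) from h
    rw [Submodule.span_le]
    rintro _ ⟨y, hy, rfl⟩
    exact Submodule.subset_span ⟨ρ t y, apply_mem_fsuPart _ t hy, by simp⟩
  · suffices h : Submodule.span E ((fun y : J => (1 : E) ⊗ₜ[O] y) '' (fsuPart O J ⇑ρ : Set J)) ≤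
        (Submodule.span E ((fun y : J => (1 : E) ⊗ₜ[O] y) '' (fsuPart O J ⇑ρ : Set J))).map
          (LinearMap.baseChange E (ρ t)) from h
    rw [Submodule.span_le]
    rintro _ ⟨y, hy, rfl⟩
    obtain ⟨z, hz, rfl⟩ := exists_mem_fsuPart_apply_eq _ t hy
    exact ⟨1 ⊗ₜ z, Submodule.subset_span ⟨z, hz, rfl⟩, by simp⟩

theorem one_tmul_eq_zero_iff [IsDomain O] [IsFractionRing O E] (y : J) :
    (1 : E) ⊗ₜ[O] y = 0 ↔ ∃ c : nonZeroDivisors O, c • y = 0 :=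
  IsLocalizedModule.eq_zero_iff (nonZeroDivisors O) (TensorProduct.mk O E J 1)

variable (E J) in
/-- The kernel of `J → E ⊗ J` is killed by a single nonzero scalar. -/
theorem exists_smul_eq_zero_of_one_tmul_eq_zero [IsDomain O] [IsNoetherianRing O]
    [IsFractionRing O E] [Module.Finite O J] :
    ∃ c : O, c ≠ 0 ∧ ∀ y : J, (1 : E) ⊗ₜ[O] y = 0 → c • y = 0 := by
  let N := LinearMap.ker (TensorProduct.mk O E J 1)
  have hN : Module.IsTorsion O N := fun x => by
    obtain ⟨c, hc⟩ := (one_tmul_eq_zero_iff (E := E) (x : J)).1 x.2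
    exact ⟨c, Subtype.ext hc⟩
  obtain ⟨c, hc, hc0⟩ := Submodule.annihilator_top_inter_nonZeroDivisors hN
  refine ⟨c, nonZeroDivisors.ne_zero hc0, fun y hy => ?_⟩
  exact congrArg Subtype.val (Submodule.mem_annihilator.1 hc (⟨y, hy⟩ : N) trivial)

theorem exists_smul_eq_one_tmul [IsDomain O] [IsFractionRing O E] (w : E ⊗[O] J) :
    ∃ (c : O) (y : J), c ≠ 0 ∧ algebraMap O E c • w = 1 ⊗ₜ y := by
  obtain ⟨⟨y, c⟩, h⟩ :=
    IsLocalizedModule.surj (nonZeroDivisors O) (TensorProduct.mk O E J 1) w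
  refine ⟨c, y, nonZeroDivisors.ne_zero c.2, ?_⟩
  rw [algebraMap_smul]
  exact h

variable [Module.Finite O J]

/-- A stable subspace killed by a polynomial with unit constant term in a dominating element comes
from the finitely surjective part of the lattice. -/
theorem le_span_fsuPart [IsDomain O] [IsNoetherianRing O] [IsFractionRing O E] {tp : H}
    (htp : Dominating tp) (a : O[X]) (ha : IsUnit (a.coeff 0))
    (U : Submodule E (E ⊗[O] J)) (hst : ∀ t, ∀ x ∈ U, LinearMap.baseChange E (ρ t) x ∈ U)
    (hU : ∀ x ∈ U, aeval (LinearMap.baseChange E (ρ tp) : Module.End E (E ⊗[O] J))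
      (a.map (algebraMap O E)) x = 0) :
    U ≤ Submodule.span E ((fun y : J => (1 : E) ⊗ₜ[O] y) '' (fsuPart O J ⇑ρ : Set J)) := by
  obtain ⟨d, hd0, hd⟩ := exists_smul_eq_zero_of_one_tmul_eq_zero (O := O) E J
  let N₀ : Submodule O J := (U.restrictScalars O).comap (TensorProduct.mk O E J 1)
  have hN₀ (y : J) : y ∈ N₀ ↔ (1 : E) ⊗ₜ[O] y ∈ U := Iff.rfl
  have hN₀st (t : H) (y : J) (hy : y ∈ N₀) : ρ t y ∈ N₀ := by
    simpa [hN₀] using hst t _ ((hN₀ y).1 hy)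
  let N : Submodule O J := N₀.map (LinearMap.lsmul O J d)
  have hNst (t : H) : ∀ x ∈ N, ρ t x ∈ N := by
    rintro _ ⟨y, hy, rfl⟩
    exact ⟨ρ t y, hN₀st t y hy, by simp⟩
  obtain ⟨u, hu⟩ := ha
  have hsurj : ∀ x ∈ N, ∃ y ∈ N, ρ tp y = x := by
    rintro _ ⟨y, hy, rfl⟩
    have h1 : aeval (ρ tp) a (d • y) = 0 := by
      rw [map_smul]
      refine hd _ ?_
      have := hU _ ((hN₀ y).1 hy)
      rwa [aeval_baseChange, LinearMap.baseChange_tmul] at this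
    have hmem : d • y ∈ N := ⟨y, hy, rfl⟩
    refine ⟨-(↑u⁻¹ : O) • aeval (ρ tp) a.divX (d • y),
      N.smul_mem _ (aeval_apply_mem (hNst tp) _ hmem), ?_⟩
    rw [← X_mul_divX_add a, map_add, map_mul, aeval_X, aeval_C, ← hu, LinearMap.add_apply,
      Module.End.mul_apply, Module.algebraMap_end_apply] at h1
    rw [map_smul, eq_neg_of_add_eq_zero_left h1, smul_neg, neg_smul, neg_neg, smul_smul,
      Units.inv_mul, one_smul]
    rfl
  have hle : N ≤ fsuPart O J ⇑ρ :=
    le_fsuPart ⟨IsNoetherian.noetherian _, hNst, htp.exists_apply_eq ρ hNst hsurj⟩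
  intro w hw
  obtain ⟨c, y, hc, h⟩ := exists_smul_eq_one_tmul w
  have hy : y ∈ N₀ := by
    rw [hN₀, ← h]
    exact U.smul_mem _ hw
  have hcd : algebraMap O E (d * c) ≠ 0 := by
    rw [Ne, IsFractionRing.to_map_eq_zero_iff]
    exact mul_ne_zero hd0 hc
  have hw' : w = (algebraMap O E (d * c))⁻¹ • ((1 : E) ⊗ₜ[O] (d • y)) := by
    rw [TensorProduct.tmul_smul, ← h, ← algebraMap_smul E d, smul_smul, smul_smul, mul_assoc,
      ← map_mul, inv_mul_cancel₀ hcd, one_smul]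
  rw [hw']
  exact Submodule.smul_mem _ _ (Submodule.subset_span ⟨_, hle ⟨y, hy, rfl⟩, rfl⟩)

theorem aeval_apply_eq_zero_of_mem_span_fsuPart [IsNoetherianRing O] [IsAlgClosed C]
    (v : AbsoluteValue C ℝ) (hint : ∀ x : C, IsIntegral O x → v x ≤ 1) (tp : H) (a b : E[X])
    (hab : aeval (LinearMap.baseChange E (ρ tp) : Module.End E (E ⊗[O] J)) (a * b) = 0)
    (hb : ∀ c : C, aeval c b = 0 → v c < 1) (x : E ⊗[O] J)
    (hx : x ∈ Submodule.span E ((fun y : J => (1 : E) ⊗ₜ[O] y) '' (fsuPart O J ⇑ρ : Set J))) :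
    aeval (LinearMap.baseChange E (ρ tp) : Module.End E (E ⊗[O] J)) a x = 0 := by
  let T : Module.End E (E ⊗[O] J) := LinearMap.baseChange E (ρ tp)
  have hres : ∀ x ∈ fsuPart O J ⇑ρ, ρ tp x ∈ fsuPart O J ⇑ρ := fun x => apply_mem_fsuPart _ tp
  obtain ⟨h, hm, h0⟩ := exists_monic_aeval_reverse_eq_zero ((ρ tp).restrict hres) <| by
    rintro ⟨y, hy⟩
    obtain ⟨z, hz, rfl⟩ := exists_mem_fsuPart_apply_eq _ tp hy
    exact ⟨⟨z, hz⟩, rfl⟩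
  have hrev (y : J) (hy : y ∈ fsuPart O J ⇑ρ) : aeval (ρ tp) h.reverse y = 0 := by
    rw [← coe_aeval_restrict hres _ ⟨y, hy⟩, h0]
    rfl
  have hcop : IsCoprime (h.reverse.map (algebraMap O E)) b := by
    rw [isCoprime_iff_aeval_ne_zero_of_isAlgClosed E C]
    by_contra! hne
    obtain ⟨c, hc, hcb⟩ := hne
    rw [aeval_map_algebraMap] at hc
    have hc0 : c ≠ 0 := by
      rintro rfl
      rw [← coeff_zero_eq_aeval_zero', coeff_zero_reverse, hm.leadingCoeff, map_one] at hc
      exact one_ne_zero hc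
    have : Invertible c⁻¹ := invertibleOfNonzero (inv_ne_zero hc0)
    have h1 : v c⁻¹ ≤ 1 := hint _ ⟨h, hm, by
      rwa [← eval₂_reverse_eq_zero_iff, invOf_eq_inv, inv_inv, ← aeval_def]⟩
    rw [map_inv₀] at h1
    have := (inv_le_one₀ (v.pos hc0)).1 h1
    exact absurd (hb c hcb) this.not_gt
  obtain ⟨r, s, hrs⟩ := hcop
  change x ∈ LinearMap.ker (aeval T a)
  refine (Submodule.span_le.2 ?_ : _ ≤ LinearMap.ker (aeval T a)) hx
  rintro _ ⟨y, hy, rfl⟩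
  have h1 : aeval T (h.reverse.map (algebraMap O E)) ((1 : E) ⊗ₜ[O] y) = 0 := by
    rw [aeval_baseChange, LinearMap.baseChange_tmul, hrev y hy, TensorProduct.tmul_zero]
  have h2 : a = (r * a) * h.reverse.map (algebraMap O E) + s * (a * b) := by
    linear_combination -a * hrs
  rw [SetLike.mem_coe, LinearMap.mem_ker, h2, map_add, map_mul, map_mul _ s, hab, mul_zero,
    add_zero, Module.End.mul_apply, h1, map_zero]

theorem baseChange_apply_eq_zero_of_mem_fsuPart (t : H) (x : E ⊗[O] J)
    (hx : x ∈ fsuPart E (E ⊗[O] J) fun t => LinearMap.baseChange E (ρ t))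
    (h0 : LinearMap.baseChange E (ρ t) x = 0) : x = 0 := by
  have hst : ∀ x ∈ fsuPart E (E ⊗[O] J) (fun t => LinearMap.baseChange E (ρ t)),
      LinearMap.baseChange E (ρ t) x ∈ fsuPart E (E ⊗[O] J) fun t => LinearMap.baseChange E (ρ t) :=
    fun x hx => apply_mem_fsuPart (fun t => LinearMap.baseChange E (ρ t)) t hx
  have hs : Function.Surjective ((LinearMap.baseChange E (ρ t)).restrict hst) := by
    rintro ⟨y, hy⟩
    obtain ⟨z, hz, hzy⟩ :=
      exists_mem_fsuPart_apply_eq (fun t => LinearMap.baseChange E (ρ t)) t hy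
    exact ⟨⟨z, hz⟩, Subtype.ext hzy⟩
  exact congrArg Subtype.val ((injective_iff_map_eq_zero _).1
    (IsNoetherian.injective_of_surjective_endomorphism _ hs) ⟨x, hx⟩ (Subtype.ext h0))

/-- A stable subspace of the finitely surjective part is killed by `a` as soon as it is killed by
`a * b` and no root of `b` is an eigenvalue of a character occurring in it. -/
theorem aeval_apply_eq_zero_of_forall_occursIn [IsAlgClosed C] (tp : H) (a b : E[X])
    (hab : aeval (LinearMap.baseChange E (ρ tp) : Module.End E (E ⊗[O] J)) (b * a) = 0)
    (U : Submodule E (E ⊗[O] J))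
    (hst : ∀ t : H, ∀ x ∈ U, LinearMap.baseChange E (ρ t) x ∈ U)
    (hU : U ≤ fsuPart E (E ⊗[O] J) fun t => LinearMap.baseChange E (ρ t))
    (hχ : ∀ χ : H →* Cˣ, OccursIn O E C J (IsScalarTower.toAlgHom O E C) ρ χ U →
      aeval (χ tp : C) b ≠ 0) :
    ∀ x ∈ U, aeval (LinearMap.baseChange E (ρ tp) : Module.End E (E ⊗[O] J)) a x = 0 := by
  let T : Module.End E (E ⊗[O] J) := LinearMap.baseChange E (ρ tp)
  let U' : Submodule E (E ⊗[O] J) := U.map (aeval T a)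
  have hU' : U' ≤ U := Submodule.map_le_iff_le_comap.2 fun x hx => aeval_apply_mem (hst tp) a hx
  suffices h : U' = ⊥ by
    intro x hx
    exact (Submodule.mem_bot E).1 (h ▸ Submodule.mem_map_of_mem hx)
  by_contra hne
  have hst' (t : H) : ∀ x ∈ U', LinearMap.baseChange E (ρ t) x ∈ U' := by
    rintro _ ⟨y, hy, rfl⟩
    exact ⟨_, hst t y hy, LinearMap.congr_fun (commute_aeval_baseChange ρ tp t a).eq y⟩
  obtain ⟨χ, x, hx, hx'⟩ := exists_occursIn (C := C) (ρ := ρ) U' hne hst'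
    fun t x hx => baseChange_apply_eq_zero_of_mem_fsuPart t x (hU (hU' hx))
  refine hχ χ ⟨x, Submodule.span_mono (Set.image_mono hU') hx, hx'⟩ ?_
  refine OccursIn.aeval_eq_zero ⟨x, hx, hx'⟩ tp b ?_
  rintro _ ⟨y, -, rfl⟩
  change aeval T b (aeval T a y) = 0
  rw [← Module.End.mul_apply, ← map_mul, hab, LinearMap.zero_apply]

theorem decomposition_of_isFractionRing [IsDomain O] [IsNoetherianRing O] [IsFractionRing O E]
    [IsAlgClosed C] [IsIntegrallyClosed O]
    (v : AbsoluteValue C ℝ) (hint : ∀ x : C, IsIntegral O x → v x ≤ 1)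
    (hO : ∀ x : E, v (algebraMap E C x) ≤ 1 → ∃ y : O, algebraMap O E y = x)
    (hconj : ∀ x y : C, minpoly E x = minpoly E y → v x = v y)
    {tp : H} (htp : Dominating tp) :
    (∃! P, GoodPair O E C J (IsScalarTower.toAlgHom O E C) v ρ P) ∧
    (∀ P, GoodPair O E C J (IsScalarTower.toAlgHom O E C) v ρ P →
      P.1 = Submodule.span E
        ((fun y : J => (1 : E) ⊗ₜ[O] y) '' (fsuPart O J ⇑ρ : Set J))) := by
  obtain ⟨q, hq, hq0⟩ := LinearMap.exists_monic_and_aeval_eq_zero O (ρ tp)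
  obtain ⟨F, b, hFb, hF0, hF, hb⟩ :=
    exists_unit_mul_nilpotent_factorization (E := E) v hint hO hconj q hq
  let a : E[X] := F.map (algebraMap O E)
  have ha (c : C) (hc : aeval c a = 0) : v c = 1 := hF c (by rwa [aeval_map_algebraMap] at hc)
  let T : Module.End E (E ⊗[O] J) := LinearMap.baseChange E (ρ tp)
  let V := fsuPart E (E ⊗[O] J) fun t => LinearMap.baseChange E (ρ t)
  let Wo := Submodule.span E ((fun y : J => (1 : E) ⊗ₜ[O] y) '' (fsuPart O J ⇑ρ : Set J))
  let Ws := V ⊓ LinearMap.ker (aeval T b)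
  have hab : aeval T (a * b) = 0 := by
    rw [hFb, aeval_baseChange, hq0, LinearMap.baseChange_zero]
  have hba : aeval T (b * a) = 0 := by rw [mul_comm, hab]
  have hVst (t : H) (x) (hx : x ∈ V) : LinearMap.baseChange E (ρ t) x ∈ V :=
    apply_mem_fsuPart (fun t => LinearMap.baseChange E (ρ t)) t hx
  have hker (g : E[X]) (t : H) (x) (hx : x ∈ V ⊓ LinearMap.ker (aeval T g)) :
      LinearMap.baseChange E (ρ t) x ∈ V ⊓ LinearMap.ker (aeval T g) := by
    refine ⟨hVst t x hx.1, ?_⟩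
    rw [SetLike.mem_coe, LinearMap.mem_ker, ← Module.End.mul_apply,
      (commute_aeval_baseChange ρ tp t g).eq, Module.End.mul_apply,
      LinearMap.mem_ker.1 hx.2, map_zero]
  have hWo : Wo = V ⊓ LinearMap.ker (aeval T a) := by
    refine le_antisymm (le_inf span_fsuPart_le_fsuPart_baseChange fun x hx => ?_) ?_
    · exact aeval_apply_eq_zero_of_mem_span_fsuPart v hint tp a b hab hb x hx
    · exact le_span_fsuPart htp F hF0 _ (hker a) fun x hx => hx.2
  have hcop : IsCoprime a b := by
    rw [isCoprime_iff_aeval_ne_zero_of_isAlgClosed E C]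
    by_contra! hne
    obtain ⟨c, hca, hcb⟩ := hne
    exact (hb c hcb).ne (ha c hca)
  have hdisj : Disjoint Wo Ws := by
    rw [hWo]
    exact (disjoint_ker_aeval_of_isCoprime T hcop).mono inf_le_right inf_le_right
  have hsup : Wo ⊔ Ws = V := by
    refine le_antisymm (sup_le (hWo ▸ inf_le_left) inf_le_left) fun x hx => ?_
    obtain ⟨r, s, hrs⟩ := hcop
    have hx1 : x = aeval T (s * b) x + aeval T (r * a) x := by
      rw [← LinearMap.add_apply, ← map_add, add_comm, hrs, map_one, Module.End.one_apply]
    rw [hx1, hWo]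
    refine Submodule.add_mem_sup ⟨aeval_apply_mem (hVst tp) _ hx, ?_⟩
      ⟨aeval_apply_mem (hVst tp) _ hx, ?_⟩
    · rw [SetLike.mem_coe, LinearMap.mem_ker, ← Module.End.mul_apply, ← map_mul, mul_left_comm,
        map_mul, hab, mul_zero, LinearMap.zero_apply]
    · rw [SetLike.mem_coe, LinearMap.mem_ker, ← Module.End.mul_apply, ← map_mul, mul_left_comm,
        map_mul, hba, mul_zero, LinearMap.zero_apply]
  have hle1 {χ : H →* Cˣ} {U : Submodule E (E ⊗[O] J)}
      (h : OccursIn O E C J (IsScalarTower.toAlgHom O E C) ρ χ U) (t : H) : v (χ t : C) ≤ 1 :=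
    hint _ (h.isIntegral t)
  have hord {χ : H →* Cˣ} {U : Submodule E (E ⊗[O] J)}
      (h : OccursIn O E C J (IsScalarTower.toAlgHom O E C) ρ χ U) (h1 : v (χ tp : C) = 1)
      (t : H) : v (χ t : C) = 1 := by
    obtain ⟨K, hK⟩ := htp t
    obtain ⟨s, hs⟩ := hK K le_rfl
    have h2 : v (χ t : C) * v (χ s : C) = 1 := by
      rw [← map_mul, ← Units.val_mul, ← map_mul, ← hs, map_pow, Units.val_pow_eq_pow_val, map_pow,
        h1, one_pow]
    refine le_antisymm (hle1 h t) ?_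
    calc (1 : ℝ) = v (χ t : C) * v (χ s : C) := h2.symm
      _ ≤ v (χ t : C) * 1 := mul_le_mul_of_nonneg_left (hle1 h s) (v.nonneg _)
      _ = v (χ t : C) := mul_one _
  have hgood : GoodPair O E C J (IsScalarTower.toAlgHom O E C) v ρ (Wo, Ws) := by
    refine ⟨hWo ▸ hker a, hker b, hdisj.eq_bot, hsup, fun χ h => ?_, fun χ h => ⟨hle1 h, ?_⟩⟩
    · exact hord h (ha _ (h.aeval_eq_zero tp a fun x hx => (hWo ▸ hx : x ∈ V ⊓ _).2))
    · exact fun h1 => (hb _ (h.aeval_eq_zero tp b fun x hx => hx.2)).ne (h1 tp)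
  have huniq (P) (hP : GoodPair O E C J (IsScalarTower.toAlgHom O E C) v ρ P) : P = (Wo, Ws) := by
    obtain ⟨P₁, P₂⟩ := P
    obtain ⟨hst₁, hst₂, hinf, hsupP, hχ₁, hχ₂⟩ := hP
    have hP₁V : P₁ ≤ V := le_sup_left.trans hsupP.le
    have hP₂V : P₂ ≤ V := le_sup_right.trans hsupP.le
    have h₁ : P₁ ≤ Wo := hWo ▸ le_inf hP₁V
      (aeval_apply_eq_zero_of_forall_occursIn tp a b hba P₁ hst₁ hP₁V fun χ h h0 =>
        (hb _ h0).ne (hχ₁ χ h tp))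
    have h₂ : P₂ ≤ Ws := le_inf hP₂V
      (aeval_apply_eq_zero_of_forall_occursIn tp b a hab P₂ hst₂ hP₂V fun χ h h0 =>
        (hχ₂ χ h).2 (hord h (ha _ h0)))
    have hsup' : Wo ⊔ Ws ≤ P₁ ⊔ P₂ := hsup.le.trans hsupP.ge
    refine Prod.ext (le_antisymm h₁ ?_) (le_antisymm h₂ ?_)
    · exact (eq_of_le_of_inf_le_of_sup_le h₁ (hdisj.le_bot.trans bot_le)
        (hsup'.trans (sup_le_sup_left h₂ _))).ge
    · exact (eq_of_le_of_inf_le_of_sup_le (z := Wo) h₂ (hdisj.symm.le_bot.trans bot_le) (by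
        rw [sup_comm, sup_comm P₂]
        exact hsup'.trans (sup_le_sup_right h₁ _))).ge
  exact ⟨⟨_, hgood, huniq⟩, fun P hP => by rw [huniq P hP]⟩

end Decomposition

theorem decomposition_of_isIntegralClosure {p : ℕ} [Fact p.Prime] {O E C : Type*} [CommRing O]
    [Field E] [Field C] [Algebra ℚ_[p] E] [FiniteDimensional ℚ_[p] E]
    [Algebra ℤ_[p] E] [IsScalarTower ℤ_[p] ℚ_[p] E] [Algebra ℤ_[p] O] [Algebra O E]
    [IsScalarTower ℤ_[p] O E] [IsIntegralClosure O ℤ_[p] E]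
    [IsAlgClosed C] [Algebra ℚ_[p] C] [Algebra.IsAlgebraic ℚ_[p] C]
    [Algebra ℤ_[p] C] [IsScalarTower ℤ_[p] ℚ_[p] C] [Algebra O C] [IsScalarTower ℤ_[p] O C]
    (ι : E →ₐ[O] C) (v : AbsoluteValue C ℝ)
    (hv : ∀ x : ℚ_[p], v (algebraMap ℚ_[p] C x) = ‖x‖)
    {H : Type*} [CommMonoid H] {J : Type*} [AddCommGroup J] [Module O J] [Module.Finite O J]
    (ρ : H →* Module.End O J) {tp : H} (htp : Dominating tp) :
    (∃! P, GoodPair O E C J ι v ρ P) ∧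
    (∀ P, GoodPair O E C J ι v ρ P →
      P.1 = Submodule.span E
        ((fun y : J => (1 : E) ⊗ₜ[O] y) '' (fsuPart O J ⇑ρ : Set J))) := by
  have : IsDomain O := (IsIntegralClosure.algebraMap_injective O ℤ_[p] E).isDomain
  have : IsFractionRing O E :=
    IsIntegralClosure.isFractionRing_of_finite_extension ℤ_[p] ℚ_[p] E O
  have : IsIntegrallyClosed O :=
    (isIntegrallyClosed_iff E).2 fun {x} hx => by
      have : Algebra.IsIntegral ℤ_[p] O := IsIntegralClosure.isIntegral_algebra ℤ_[p] E
      exact IsIntegralClosure.isIntegral_iff.1 (isIntegral_trans (R := ℤ_[p]) x hx)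
  have : IsNoetherianRing O := IsIntegralClosure.isNoetherianRing ℤ_[p] ℚ_[p] E O
  let : Algebra E C := ι.toRingHom.toAlgebra
  have : IsScalarTower O E C := IsScalarTower.of_algebraMap_eq fun x => (ι.commutes x).symm
  have : IsScalarTower ℤ_[p] E C := IsScalarTower.of_algebraMap_eq fun x => by
    rw [IsScalarTower.algebraMap_apply ℤ_[p] O C, IsScalarTower.algebraMap_apply ℤ_[p] O E,
      ← IsScalarTower.algebraMap_apply O E C]
  have : IsScalarTower ℚ_[p] E C := IsScalarTower.of_algebraMap_eq' <|
    IsLocalization.ringHom_ext (nonZeroDivisors ℤ_[p]) <| RingHom.ext fun x => by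
      simp only [RingHom.comp_apply]
      rw [← IsScalarTower.algebraMap_apply ℤ_[p] ℚ_[p] C,
        ← IsScalarTower.algebraMap_apply ℤ_[p] ℚ_[p] E,
        ← IsScalarTower.algebraMap_apply ℤ_[p] E C]
  have hι : ι = IsScalarTower.toAlgHom O E C := AlgHom.ext fun _ => rfl
  have : Algebra.IsIntegral ℤ_[p] O := IsIntegralClosure.isIntegral_algebra ℤ_[p] E
  rw [hι]
  refine decomposition_of_isFractionRing v (fun x hx => ?_) (fun x hx => ?_)
    (absoluteValue_eq_of_minpoly_eq v hv) htp
  · exact (absoluteValue_le_one_iff_isIntegral v hv x).2 (isIntegral_trans x hx)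
  · rw [absoluteValue_le_one_iff_isIntegral v hv,
      isIntegral_algebraMap_iff (algebraMap E C).injective] at hx
    exact IsIntegralClosure.isIntegral_iff.1 hx

/-- Let `O` be the ring of integers of a finite extension `E` of `ℚ_p`, let `C` be an algebraic
closure of `ℚ_p` equipped with the unique extension `v` of the `p`-adic absolute value, and
assume the commutative monoid `H⁺` has a dominating element.  Let `J` be an `O[H⁺]`-module which
is finitely generated as an `O`-module.  Then there is a unique decomposition
`(J ⊗_O E)_fsu = W_ord ⊕ W_sup` into `H⁺`-stable `E`-subspaces such that every character
occurring in `W_ord ⊗_E C` is ordinary and every character occurring in `W_sup ⊗_E C` is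
supersingular.  Moreover, `W_ord = J_fsu ⊗_O E` (the `E`-span of the image of `J_fsu` in
`E ⊗_O J`). -/
theorem ordinary_supersingular_decomposition
    (p : ℕ) [Fact p.Prime] (E : Type*) [Field E]
    [Algebra ℚ_[p] E] [FiniteDimensional ℚ_[p] E]
    [Algebra ℤ_[p] E] [IsScalarTower ℤ_[p] ℚ_[p] E]
    (C : Type*) [Field C] [IsAlgClosed C]
    [Algebra ℚ_[p] C] [Algebra.IsAlgebraic ℚ_[p] C]
    [Algebra ℤ_[p] C] [IsScalarTower ℤ_[p] ℚ_[p] C]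
    [Algebra (PadicROI p E) C] [IsScalarTower ℤ_[p] (PadicROI p E) C]
    (ι : E →ₐ[PadicROI p E] C)
    (v : AbsoluteValue C ℝ)
    (hv : ∀ x : ℚ_[p], v (algebraMap ℚ_[p] C x) = ‖x‖)
    {H : Type*} [CommMonoid H]
    (J : Type*) [AddCommGroup J] [Module (PadicROI p E) J] [Module.Finite (PadicROI p E) J]
    (ρ : H →* Module.End (PadicROI p E) J)
    (hdom : ∃ tp : H, Dominating tp) :
    (∃! P, GoodPair (PadicROI p E) E C J ι v ρ P) ∧
    (∀ P, GoodPair (PadicROI p E) E C J ι v ρ P →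
      P.1 = Submodule.span E
        ((fun y : J => (1 : E) ⊗ₜ[PadicROI p E] y) ''
          ↑(fsuPart (PadicROI p E) J ⇑ρ))) := by
  obtain ⟨tp, htp⟩ := hdom
  exact decomposition_of_isIntegralClosure ι v hv ρ htp
end

section
/- Let 𝔊, 𝔊' be subgroups of G with 𝔊 ⪯_P 𝔊'. Then 𝔊' = (𝔊 ∩ 𝔊')·𝔓' and P ∩ (𝔊·𝔊') = 𝔓', where 𝔓' = 𝔊' ∩ P and the products are products of subsets of G. -/
open scoped Pointwise

/-- Let `G` be a group and `P` a subgroup.  For subgroups `𝔊, 𝔊'` of `G` with `𝔓 = 𝔊 ⊓ P` and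
`𝔓' = 𝔊' ⊓ P`, suppose `𝔊 ⪯_P 𝔊'`, i.e. `𝔓 ⊆ 𝔓'` and `𝔊' ⊆ 𝔊·𝔓'`.  Then
`𝔊' = (𝔊 ∩ 𝔊')·𝔓'` and `P ∩ (𝔊·𝔊') = 𝔓'` (products of subsets of `G`). -/
theorem preceq_consequences {G : Type*} [Group G] (P 𝔊 𝔊' : Subgroup G)
    (h1 : 𝔊 ⊓ P ≤ 𝔊' ⊓ P)
    (h2 : (𝔊' : Set G) ⊆ (𝔊 : Set G) * ((𝔊' ⊓ P : Subgroup G) : Set G)) :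
    (𝔊' : Set G) = ((𝔊 ⊓ 𝔊' : Subgroup G) : Set G) * ((𝔊' ⊓ P : Subgroup G) : Set G) ∧
    (P : Set G) ∩ ((𝔊 : Set G) * (𝔊' : Set G)) = ((𝔊' ⊓ P : Subgroup G) : Set G) := by
  constructor
  · ext x
    constructor
    · intro hx
      obtain ⟨g, hg, q, hq, rfl⟩ := h2 hx
      exact ⟨g, ⟨hg, (𝔊'.mul_mem_cancel_right hq.1).1 hx⟩, q, hq, rfl⟩
    · rintro ⟨g, hg, q, hq, rfl⟩
      exact 𝔊'.mul_mem hg.2 hq.1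
  · ext x
    constructor
    · rintro ⟨hxP, g, hg, y, hy, rfl⟩
      obtain ⟨k, hk, q, hq, rfl⟩ := h2 hy
      have hxP' : g * k * q ∈ P := by simpa only [mul_assoc, SetLike.mem_coe] using hxP
      have hgk : g * k ∈ 𝔊' ⊓ P :=
        h1 ⟨𝔊.mul_mem hg hk, (P.mul_mem_cancel_right hq.2).1 hxP'⟩
      simpa only [mul_assoc, SetLike.mem_coe] using (𝔊' ⊓ P).mul_mem hgk hq
    · intro hx
      exact ⟨hx.2, 1, 𝔊.one_mem, x, hx.1, one_mul x⟩
end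

section
/- Let 𝔊₁, 𝔊₂, 𝔊₃ be subgroups of G with 𝔊₁ ⪯_P 𝔊₂ and 𝔊₂ ⪯_P 𝔊₃. Then 𝔊₂ = (𝔊₁ ∩ 𝔊₂)·(𝔊₂ ∩ 𝔊₃) (product of subsets of G) and 𝔊₁ ∩ 𝔊₃ ⊆ 𝔊₂. -/
open scoped Pointwise

/-- For subgroups `A, B` of a group `G` with a fixed subgroup `P`, the relation `A ⪯_P B` means
`A ⊓ P ⊆ B ⊓ P` and `B ⊆ A·(B ⊓ P)` (product of subsets of `G`). -/
def Preceq {G : Type*} [Group G] (P A B : Subgroup G) : Prop :=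
  A ⊓ P ≤ B ⊓ P ∧ (B : Set G) ⊆ (A : Set G) * ((B ⊓ P : Subgroup G) : Set G)

/-- Let `𝔊₁, 𝔊₂, 𝔊₃` be subgroups of `G` with `𝔊₁ ⪯_P 𝔊₂` and `𝔊₂ ⪯_P 𝔊₃`.  Then
`𝔊₂ = (𝔊₁ ∩ 𝔊₂)·(𝔊₂ ∩ 𝔊₃)` (product of subsets of `G`) and `𝔊₁ ∩ 𝔊₃ ⊆ 𝔊₂`. -/
theorem preceq_chain {G : Type*} [Group G] (P 𝔊₁ 𝔊₂ 𝔊₃ : Subgroup G)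
    (h12 : Preceq P 𝔊₁ 𝔊₂) (h23 : Preceq P 𝔊₂ 𝔊₃) :
    (𝔊₂ : Set G) = ((𝔊₁ ⊓ 𝔊₂ : Subgroup G) : Set G) * ((𝔊₂ ⊓ 𝔊₃ : Subgroup G) : Set G) ∧
    𝔊₁ ⊓ 𝔊₃ ≤ 𝔊₂ := by
  obtain ⟨hP12, h2⟩ := h12
  obtain ⟨hP23, h3⟩ := h23
  -- The left factor may be taken in `𝔊₁ ⊓ 𝔊₂`.
  have factor : ∀ x ∈ 𝔊₂, ∃ a ∈ 𝔊₁ ⊓ 𝔊₂, ∃ r ∈ 𝔊₂ ⊓ P, a * r = x := by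
    intro x hx
    obtain ⟨a, ha, r, hr, rfl⟩ := Set.mem_mul.1 (h2 hx)
    exact ⟨a, ⟨ha, (Subgroup.mul_mem_cancel_right 𝔊₂ hr.1).1 hx⟩, r, hr, rfl⟩
  refine ⟨Set.Subset.antisymm (fun x hx => ?_) ?_, fun x hx => ?_⟩
  · obtain ⟨a, ha, r, hr, rfl⟩ := factor x hx
    exact Set.mul_mem_mul ha ⟨hr.1, (hP23 hr).1⟩
  · rintro _ ⟨a, ha, b, hb, rfl⟩
    exact 𝔊₂.mul_mem ha.2 hb.1
  · obtain ⟨g, hg, q, hq, rfl⟩ := Set.mem_mul.1 (h3 hx.2)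
    obtain ⟨a, ha, r, hr, rfl⟩ := factor g hg
    have hx1 : a * (r * q) ∈ 𝔊₁ := mul_assoc a r q ▸ hx.1
    have hrq : r * q ∈ 𝔊₁ ⊓ P :=
      ⟨(Subgroup.mul_mem_cancel_left 𝔊₁ ha.1).1 hx1, P.mul_mem hr.2 hq.2⟩
    rw [mul_assoc]
    exact 𝔊₂.mul_mem ha.2 (hP12 hrq).1
end

section
/- The relation ⪯_P is a partial order on the set of subgroups of G: it is reflexive, antisymmetric, and transitive. -/
open scoped Pointwise

/-- The relation `⪯_P` is a partial order on the set of subgroups of `G`: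
it is reflexive, antisymmetric and transitive. -/
theorem preceq_partialOrder {G : Type*} [Group G] (P : Subgroup G) :
    (∀ A : Subgroup G, Preceq P A A) ∧
    (∀ A B : Subgroup G, Preceq P A B → Preceq P B A → A = B) ∧
    (∀ A B C : Subgroup G, Preceq P A B → Preceq P B C → Preceq P A C) := by
  refine ⟨fun A => ⟨le_rfl, fun a ha => ?_⟩, ?_, ?_⟩
  · exact Set.mem_mul.2 ⟨a, ha, 1, one_mem _, mul_one a⟩
  · have le_of_preceq : ∀ A B : Subgroup G, Preceq P A B → Preceq P B A → B ≤ A := by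
      rintro A B ⟨-, hAB⟩ ⟨hBA, -⟩ b hb
      obtain ⟨a, ha, q, hq, rfl⟩ := Set.mem_mul.1 (hAB hb)
      exact mul_mem ha (hBA hq).1
    exact fun A B hAB hBA => le_antisymm (le_of_preceq B A hBA hAB) (le_of_preceq A B hAB hBA)
  · rintro A B C ⟨hAB, hB⟩ ⟨hBC, hC⟩
    refine ⟨hAB.trans hBC, fun c hc => ?_⟩
    obtain ⟨b, hb, r, hr, rfl⟩ := Set.mem_mul.1 (hC hc)
    obtain ⟨a, ha, q, hq, rfl⟩ := Set.mem_mul.1 (hB hb)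
    exact Set.mem_mul.2 ⟨a, ha, q * r, mul_mem (hBC hq) hr, (mul_assoc a q r).symm⟩
end
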